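/- arXiv:1005.5726 — 10 statements merged into one kernel-verified Lean document; each statement's English description precedes it below -/
import Mathlib

section
/- Star presentation of the symmetric group (Proposition 1.1): let n ≥ 3 and let R be the subset of the free group on generators y_1, …, y_{n−1} consisting of the words y_l·y_{l−1}·(y_{l−2}·y_{l−3} ⋯ y_{k+1}·y_k)·y_l·(y_{l−1}·(y_{l−2} ⋯ y_k)·y_l·y_{l−1})⁻¹ for all 0 < k < l < n, together with the words y_k·y_k for all 0 < k < n. Then the group homomorphism from the presented group PresentedGroup R to Equiv.Perm (Fin n) sending the generator y_k to the transposition Equiv.swap 0 k is a group isomorphism. -/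
/-- The free-group letter `y_j` (for `0 < j < n`) in the free group on the
generators `y_1, …, y_{n-1}`; equal to `1` for indices out of range. -/
def starLetter (n j : ℕ) : FreeGroup {k : ℕ // 0 < k ∧ k < n} :=
  if h : 0 < j ∧ j < n then FreeGroup.of ⟨j, h⟩ else 1

/-- The decreasing word `y_{l-2} · y_{l-3} ⋯ y_{k+1} · y_k`
(the empty word `1` when `l = k + 1`). -/
def starLetterDescWord (n k l : ℕ) : FreeGroup {k : ℕ // 0 < k ∧ k < n} :=
  ((List.range (l - 1 - k)).map fun t => starLetter n (l - 2 - t)).prod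

/-- The relators of the star presentation of `S_n`: the words
`y_l y_{l-1} (y_{l-2} ⋯ y_k) y_l · (y_{l-1} (y_{l-2} ⋯ y_k) y_l y_{l-1})⁻¹`
for `0 < k < l < n`, together with the words `y_k y_k` for `0 < k < n`. -/
def starRelators (n : ℕ) : Set (FreeGroup {k : ℕ // 0 < k ∧ k < n}) :=
  {w | ∃ k l : ℕ, 0 < k ∧ k < l ∧ l < n ∧
      w = starLetter n l * starLetter n (l - 1) * starLetterDescWord n k l * starLetter n l *
        (starLetter n (l - 1) * starLetterDescWord n k l * starLetter n l *
          starLetter n (l - 1))⁻¹} ∪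
  {w | ∃ k : ℕ, 0 < k ∧ k < n ∧ w = starLetter n k * starLetter n k}

/-- In a group where `a` and `b` are involutions satisfying the braid relation, the relation
`a b d a = b d a b` says that `d` commutes with `a b a`. -/
theorem mul_mul_mul_eq_iff_commute {G : Type*} [Group G] {a b d : G} (ha : a * a = 1)
    (hb : b * b = 1) (hab : a * b * a = b * a * b) :
    a * b * d * a = b * d * a * b ↔ Commute d (a * b * a) := by
  have h₁ : b * (a * b * a) * (d * a) = a * b * d * a := by
    rw [hab]
    simp only [← mul_assoc, hb, one_mul]
  have h₂ : b * d * (a * b * a) * a = b * d * a * b := by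
    simp only [mul_assoc, ha, mul_one]
  have h₃ : b * (a * b * a) * (d * a) = b * ((a * b * a) * d) * a := by group
  have h₄ : b * d * (a * b * a) * a = b * (d * (a * b * a)) * a := by group
  rw [← h₁, ← h₂, h₃, h₄, mul_left_inj, mul_right_inj, Commute, SemiconjBy, eq_comm]

theorem starLetterDescWord_eq_one (n k l : ℕ) (h : l ≤ k + 1) : starLetterDescWord n k l = 1 := by
  simp [starLetterDescWord, show l - 1 - k = 0 by omega]

theorem starLetterDescWord_eq_mul (n k l : ℕ) (h : k + 1 < l) :
    starLetterDescWord n k l = starLetterDescWord n (k + 1) l * starLetter n k := by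
  unfold starLetterDescWord
  rw [show l - 1 - k = l - 1 - (k + 1) + 1 by omega, List.range_succ]
  simp [show l - 2 - (l - 1 - (k + 1)) = k by omega]

/-- The subgroup generated by `y 1, …, y (m - 1)`. -/
def starSubgroup {G : Type*} [Group G] (y : ℕ → G) (m : ℕ) : Subgroup G :=
  Subgroup.closure (y '' Set.Ioo 0 m)

section StarSubgroup

variable {G : Type*} [Group G] {y : ℕ → G}

theorem mem_starSubgroup {k m : ℕ} (hk : 0 < k) (hkm : k < m) : y k ∈ starSubgroup y m :=
  Subgroup.subset_closure ⟨k, ⟨hk, hkm⟩, rfl⟩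

theorem starSubgroup_mono {l m : ℕ} (h : l ≤ m) : starSubgroup y l ≤ starSubgroup y m :=
  Subgroup.closure_mono (Set.image_mono (Set.Ioo_subset_Ioo_right h))

theorem starSubgroup_one : starSubgroup y 1 = ⊥ := by
  rw [starSubgroup, Subgroup.closure_eq_bot_iff]
  rintro _ ⟨k, ⟨h₀, h₁⟩, rfl⟩
  omega

/-- Induction principle: a property of elements that holds at `1` and is stable under left
multiplication by the involutive generators holds on `starSubgroup y m`. -/
@[elab_as_elim]
theorem starSubgroup_induction {m : ℕ} (sq : ∀ k, 0 < k → k < m → y k * y k = 1)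
    {p : G → Prop} (one : p 1) (mul : ∀ k, 0 < k → k < m → ∀ x, p x → p (y k * x)) {x : G}
    (hx : x ∈ starSubgroup y m) : p x := by
  refine Subgroup.closure_induction_left (p := fun x _ => p x) one ?_ ?_ hx
  · rintro _ ⟨k, ⟨h₀, h₁⟩, rfl⟩ x _ h
    exact mul k h₀ h₁ x h
  · rintro _ ⟨k, ⟨h₀, h₁⟩, rfl⟩ x _ h
    rw [inv_eq_of_mul_eq_one_left (sq k h₀ h₁)]
    exact mul k h₀ h₁ x h

/-- Double coset decomposition of the subgroup generated by `y 1, …, y m` with respect to the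
subgroup generated by `y 1, …, y (m - 1)`. -/
theorem starSubgroup_succ_cases {n : ℕ} (sq : ∀ k, 0 < k → k < n → y k * y k = 1)
    (braid : ∀ k, 0 < k → k + 1 < n → y (k + 1) * y k * y (k + 1) = y k * y (k + 1) * y k)
    (comm : ∀ k l, 0 < k → k < l → l + 1 < n → Commute (y k) (y (l + 1) * y l * y (l + 1)))
    {m : ℕ} (hm : 0 < m) (hmn : m < n) {x : G} (hx : x ∈ starSubgroup y (m + 1)) :
    x ∈ starSubgroup y m ∨ ∃ a ∈ starSubgroup y m, ∃ b ∈ starSubgroup y m, x = a * y m * b := by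
  induction m, hm using Nat.le_induction generalizing x with
  | base =>
    refine starSubgroup_induction (fun k h₀ h₁ => sq k h₀ (by omega)) (Or.inl (one_mem _)) ?_ hx
    intro k h₀ h₁ x hx
    obtain rfl : k = 1 := by omega
    simp only [Nat.succ_eq_add_one, zero_add, starSubgroup_one, Subgroup.mem_bot, exists_eq_left, one_mul, mul_one] at hx ⊢
    rcases hx with rfl | rfl
    · exact Or.inr (mul_one _)
    · exact Or.inl (sq 1 one_pos hmn)
  | succ m hm ih =>
    have ih := fun {x : G} => @ih (by omega) x
    obtain ⟨s, hs⟩ : ∃ s, s = y (m + 1) * y m * y (m + 1) := ⟨_, rfl⟩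
    have hym : y m ∈ starSubgroup y (m + 1) := mem_starSubgroup hm (by omega)
    have hsqm := sq m hm (by omega)
    have hsqm' := sq (m + 1) (by omega) hmn
    have hs' : s = y m * y (m + 1) * y m := hs.trans (braid m hm hmn)
    have hys : y (m + 1) = y m * s * y m := by
      rw [hs']
      calc y (m + 1) = (y m * y m) * y (m + 1) * (y m * y m) := by rw [hsqm]; group
        _ = _ := by group
    have hss : s * s = 1 := by
      calc s * s = y (m + 1) * (y m * (y (m + 1) * y (m + 1)) * y m) * y (m + 1) := by
            rw [hs]; group
        _ = 1 := by rw [hsqm', mul_one, hsqm, mul_one, hsqm']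
    have hsys : s * y m * s = y m * s * y m := by
      calc s * y m * s = y m * y (m + 1) * (y m * y m) * s := by nth_rw 1 [hs']; group
        _ = y m * (y (m + 1) * y (m + 1)) * (y m * y (m + 1)) := by rw [hsqm, hs]; group
        _ = y m * y m * y (m + 1) := by rw [hsqm']; group
        _ = _ := by rw [hsqm, one_mul, hys]
    have hcomm : ∀ a ∈ starSubgroup y m, s * a = a * s := by
      intro a ha
      refine starSubgroup_induction (p := fun a => s * a = a * s)
        (fun k h₀ h₁ => sq k h₀ (by omega)) (by simp) ?_ ha
      intro k h₀ h₁ x hx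
      have hks : Commute (y k) s := hs ▸ comm k m h₀ h₁ hmn
      rw [mul_assoc, ← hx, ← mul_assoc, ← mul_assoc, hks.eq]
    suffices H : x ∈ starSubgroup y (m + 1) ∨
        ∃ a ∈ starSubgroup y (m + 1), ∃ b ∈ starSubgroup y (m + 1), x = a * s * b by
      refine H.imp_right ?_
      rintro ⟨a, ha, b, hb, rfl⟩
      refine ⟨a * y m, mul_mem ha hym, y m * b, mul_mem hym hb, ?_⟩
      rw [hs']
      group
    have mul_left : ∀ g ∈ starSubgroup y (m + 1), ∀ x : G, (x ∈ starSubgroup y (m + 1) ∨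
        ∃ a ∈ starSubgroup y (m + 1), ∃ b ∈ starSubgroup y (m + 1), x = a * s * b) →
        (g * x ∈ starSubgroup y (m + 1) ∨
        ∃ a ∈ starSubgroup y (m + 1), ∃ b ∈ starSubgroup y (m + 1), g * x = a * s * b) := by
      rintro g hg x (hx | ⟨a, ha, b, hb, rfl⟩)
      · exact Or.inl (mul_mem hg hx)
      · exact Or.inr ⟨g * a, mul_mem hg ha, b, hb, by group⟩
    have mul_s : ∀ x : G, (x ∈ starSubgroup y (m + 1) ∨
        ∃ a ∈ starSubgroup y (m + 1), ∃ b ∈ starSubgroup y (m + 1), x = a * s * b) →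
        (s * x ∈ starSubgroup y (m + 1) ∨
        ∃ a ∈ starSubgroup y (m + 1), ∃ b ∈ starSubgroup y (m + 1), s * x = a * s * b) := by
      rintro x (hx | ⟨a, ha, b, hb, rfl⟩)
      · exact Or.inr ⟨1, one_mem _, x, hx, by simp⟩
      · rcases ih ha with ha' | ⟨c, hc, d, hd, rfl⟩
        · left
          have h : s * (a * s * b) = a * b := by
            calc s * (a * s * b) = (s * a) * s * b := by group
              _ = a * (s * s) * b := by rw [hcomm a ha']; group
              _ = a * b := by rw [hss, mul_one]
          exact h ▸ mul_mem ha hb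
        · right
          have hle : starSubgroup y m ≤ starSubgroup y (m + 1) := starSubgroup_mono (by omega)
          refine ⟨c * y m, mul_mem (hle hc) hym, y m * d * b,
            mul_mem (mul_mem hym (hle hd)) hb, ?_⟩
          calc s * (c * y m * d * s * b) = (s * c) * y m * (d * s) * b := by group
            _ = c * (s * y m * s) * d * b := by rw [hcomm c hc, ← hcomm d hd]; group
            _ = c * y m * s * (y m * d * b) := by rw [hsys]; group
    refine starSubgroup_induction (fun k h₀ h₁ => sq k h₀ (by omega)) (Or.inl (one_mem _)) ?_ hx
    intro k h₀ h₁ x hx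
    rcases Nat.lt_succ_iff_lt_or_eq.mp h₁ with h | rfl
    · exact mul_left _ (mem_starSubgroup h₀ h) x hx
    · rw [hys, mul_assoc, mul_assoc]
      exact mul_left _ hym _ (mul_s _ (mul_left _ hym _ hx))

end StarSubgroup

/-- The transposition of `0` and `j` in `Equiv.Perm (Fin n)` for `j < n`, and `1` otherwise. -/
def starSwap (n j : ℕ) : Equiv.Perm (Fin n) :=
  if h : j < n then Equiv.swap ⟨0, by omega⟩ ⟨j, h⟩ else 1

theorem starSwap_of_lt {n j : ℕ} (h : j < n) :
    starSwap n j = Equiv.swap ⟨0, by omega⟩ ⟨j, h⟩ := dif_pos h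

theorem starSwap_mul_self (n j : ℕ) : starSwap n j * starSwap n j = 1 := by
  unfold starSwap
  split_ifs <;> simp

theorem starSwap_conj {n i j : ℕ} (hj : 0 < j) (hij : i ≠ j) (hin : i < n)
    (hjn : j < n) :
    starSwap n i * starSwap n j * starSwap n i = Equiv.swap ⟨i, hin⟩ ⟨j, hjn⟩ := by
  rw [starSwap_of_lt hin, starSwap_of_lt hjn, Equiv.swap_comm _ (⟨j, hjn⟩ : Fin n),
    Equiv.swap_mul_swap_mul_swap] <;> simp [Fin.ext_iff] <;> omega

theorem starSwap_braid {n k : ℕ} (hk : 0 < k) (hkn : k + 1 < n) :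
    starSwap n (k + 1) * starSwap n k * starSwap n (k + 1) =
      starSwap n k * starSwap n (k + 1) * starSwap n k := by
  rw [starSwap_conj hk (by omega) hkn (by omega),
    starSwap_conj (by omega) (by omega) (by omega) hkn, Equiv.swap_comm]

theorem starSwap_commute {n k l : ℕ} (hk : 0 < k) (hkl : k < l) (hln : l + 1 < n) :
    Commute (starSwap n k) (starSwap n (l + 1) * starSwap n l * starSwap n (l + 1)) := by
  rw [starSwap_conj (by omega) (by omega) hln (by omega),
    starSwap_of_lt (show k < n by omega)]
  refine Equiv.Perm.Disjoint.commute (Equiv.Perm.disjoint_iff_eq_or_eq.mpr fun x => ?_)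
  by_cases h : x = ⟨0, by omega⟩ ∨ x = ⟨k, by omega⟩
  · right
    apply Equiv.swap_apply_of_ne_of_ne <;> rcases h with rfl | rfl <;>
      simp [Fin.ext_iff] <;> omega
  · rw [not_or] at h
    exact Or.inl (Equiv.swap_apply_of_ne_of_ne h.1 h.2)

theorem lift_starSwap_starLetter {n j : ℕ} (h₀ : 0 < j) (hj : j < n) :
    FreeGroup.lift (fun k : {k : ℕ // 0 < k ∧ k < n} => starSwap n k) (starLetter n j) =
      starSwap n j := by
  simp [starLetter, h₀, hj]

theorem lift_starSwap_eq_one (n : ℕ) : ∀ w ∈ starRelators n,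
    FreeGroup.lift (fun k : {k : ℕ // 0 < k ∧ k < n} => starSwap n k) w = 1 := by
  rintro _ (⟨k, l, hk, hkl, hln, rfl⟩ | ⟨k, hk, hkn, rfl⟩)
  · obtain ⟨l, rfl⟩ : ∃ m, l = m + 1 := ⟨l - 1, by omega⟩
    rw [map_mul, map_inv, mul_inv_eq_one]
    simp only [map_mul, Nat.add_sub_cancel]
    rw [lift_starSwap_starLetter (by omega) hln, lift_starSwap_starLetter (by omega) (by omega),
      mul_mul_mul_eq_iff_commute (starSwap_mul_self _ _) (starSwap_mul_self _ _)
        (starSwap_braid (by omega) hln)]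
    have hkl' : k ≤ l := by omega
    clear hkl
    induction hkl' using Nat.decreasingInduction with
    | self =>
      rw [starLetterDescWord_eq_one _ _ _ le_rfl, map_one]
      exact Commute.one_left _
    | of_succ k h ih =>
      rw [starLetterDescWord_eq_mul _ _ _ (by omega), map_mul,
        lift_starSwap_starLetter hk (by omega)]
      exact (ih (by omega)).mul_left (starSwap_commute hk h hln)
  · rw [map_mul, lift_starSwap_starLetter hk hkn, starSwap_mul_self]

/-- The homomorphism from the star-presented group to `Equiv.Perm (Fin n)` sending `y_k` to the
transposition of `0` and `k`. -/
def starHom (n : ℕ) : PresentedGroup (starRelators n) →* Equiv.Perm (Fin n) :=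
  PresentedGroup.toGroup (lift_starSwap_eq_one n)

/-- The image of `y_j` in the star-presented group. -/
def starGen (n j : ℕ) : PresentedGroup (starRelators n) :=
  PresentedGroup.mk (starRelators n) (starLetter n j)

theorem starGen_eq_of {n k : ℕ} (h : 0 < k ∧ k < n) : starGen n k = PresentedGroup.of ⟨k, h⟩ := by
  simp [starGen, starLetter, h, PresentedGroup.of]

theorem starHom_starGen {n k : ℕ} (h₀ : 0 < k) (h : k < n) :
    starHom n (starGen n k) = starSwap n k := by
  rw [starGen_eq_of ⟨h₀, h⟩, starHom, PresentedGroup.toGroup.of]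

theorem starGen_mul_self {n k : ℕ} (h₀ : 0 < k) (h : k < n) :
    starGen n k * starGen n k = 1 := by
  rw [starGen, ← map_mul]
  exact PresentedGroup.one_of_mem (Or.inr ⟨k, h₀, h, rfl⟩)

theorem starGen_relation {n k l : ℕ} (hk : 0 < k) (hkl : k ≤ l) (hln : l + 1 < n) :
    starGen n (l + 1) * starGen n l *
        PresentedGroup.mk (starRelators n) (starLetterDescWord n k (l + 1)) * starGen n (l + 1) =
      starGen n l * PresentedGroup.mk (starRelators n) (starLetterDescWord n k (l + 1)) *
        starGen n (l + 1) * starGen n l := by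
  simp only [starGen, ← map_mul]
  rw [← mul_inv_eq_one, ← map_inv, ← map_mul]
  exact PresentedGroup.one_of_mem (Or.inl ⟨k, l + 1, hk, by omega, hln, rfl⟩)

theorem starGen_braid {n k : ℕ} (hk : 0 < k) (hkn : k + 1 < n) :
    starGen n (k + 1) * starGen n k * starGen n (k + 1) =
      starGen n k * starGen n (k + 1) * starGen n k := by
  simpa [starLetterDescWord_eq_one _ _ _ le_rfl] using starGen_relation hk le_rfl hkn

theorem starGen_commute {n k l : ℕ} (hk : 0 < k) (hkl : k < l) (hln : l + 1 < n) :
    Commute (starGen n k) (starGen n (l + 1) * starGen n l * starGen n (l + 1)) := by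
  have key : ∀ j, 0 < j → j ≤ l →
      Commute (PresentedGroup.mk (starRelators n) (starLetterDescWord n j (l + 1)))
        (starGen n (l + 1) * starGen n l * starGen n (l + 1)) := fun j hj hjl =>
    (mul_mul_mul_eq_iff_commute (starGen_mul_self (by omega) hln)
      (starGen_mul_self (by omega) (by omega)) (starGen_braid (by omega) hln)).mp
      (starGen_relation hj hjl hln)
  have h := (key (k + 1) (by omega) hkl).inv_left.mul_left (key k hk hkl.le)
  rwa [starLetterDescWord_eq_mul n k (l + 1) (by omega), map_mul, inv_mul_cancel_left] at h

theorem starSubgroup_starGen (n : ℕ) : starSubgroup (starGen n) n = ⊤ := by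
  rw [eq_top_iff, ← PresentedGroup.closure_range_of (starRelators n), Subgroup.closure_le]
  rintro _ ⟨⟨k, h⟩, rfl⟩
  rw [← starGen_eq_of h]
  exact mem_starSubgroup h.1 h.2

theorem starHom_apply_eq_self {n m : ℕ} (hm : 0 < m) (hmn : m < n)
    {x : PresentedGroup (starRelators n)} (hx : x ∈ starSubgroup (starGen n) m) :
    starHom n x ⟨m, hmn⟩ = ⟨m, hmn⟩ := by
  refine starSubgroup_induction (p := fun x => starHom n x ⟨m, hmn⟩ = ⟨m, hmn⟩)
    (fun k h₀ h₁ => starGen_mul_self h₀ (by omega)) (by simp) ?_ hx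
  intro k h₀ h₁ x hx
  rw [map_mul, Equiv.Perm.mul_apply, hx, starHom_starGen h₀ (by omega),
    starSwap_of_lt (by omega)]
  apply Equiv.swap_apply_of_ne_of_ne <;> simp [Fin.ext_iff] <;> omega

theorem eq_one_of_starHom_eq_one {n m : ℕ} (hm : 0 < m) (hmn : m ≤ n)
    {x : PresentedGroup (starRelators n)} (hx : x ∈ starSubgroup (starGen n) m)
    (h : starHom n x = 1) : x = 1 := by
  induction m, hm using Nat.le_induction with
  | base => simpa [starSubgroup_one] using hx
  | succ m hm ih =>
    rcases starSubgroup_succ_cases (fun _ => starGen_mul_self) (fun _ => starGen_braid)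
      (fun _ _ => starGen_commute) hm hmn hx with hx | ⟨a, ha, b, hb, rfl⟩
    · exact ih (by omega) hx
    · have hfix := DFunLike.congr_fun h ⟨m, hmn⟩
      rw [map_mul, map_mul, Equiv.Perm.mul_apply, Equiv.Perm.mul_apply,
        starHom_apply_eq_self hm hmn hb, starHom_starGen hm hmn, starSwap_of_lt hmn,
        Equiv.swap_apply_right, Equiv.Perm.one_apply] at hfix
      have := (starHom n a).injective (hfix.trans (starHom_apply_eq_self hm hmn ha).symm)
      simp only [Fin.mk.injEq] at this
      omega

theorem starHom_injective {n : ℕ} (hn : 0 < n) : Function.Injective (starHom n) :=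
  (injective_iff_map_eq_one _).mpr fun _ =>
    eq_one_of_starHom_eq_one hn le_rfl (starSubgroup_starGen n ▸ Subgroup.mem_top _)

theorem starHom_surjective (n : ℕ) : Function.Surjective (starHom n) := by
  rw [← MonoidHom.range_eq_top, eq_top_iff, ← Equiv.Perm.closure_isSwap, Subgroup.closure_le]
  have mem : ∀ k, 0 < k → k < n → starSwap n k ∈ (starHom n).range := fun k h₀ h =>
    ⟨_, starHom_starGen h₀ h⟩
  rintro _ ⟨⟨i, hi⟩, ⟨j, hj⟩, hij, rfl⟩
  replace hij : i ≠ j := fun h => hij (Fin.ext h)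
  rcases Nat.eq_zero_or_pos i with rfl | hi₀
  · rw [← starSwap_of_lt hj]
    exact mem j (by omega) hj
  rcases Nat.eq_zero_or_pos j with rfl | hj₀
  · rw [Equiv.swap_comm, ← starSwap_of_lt hi]
    exact mem i hi₀ hi
  · rw [← starSwap_conj hj₀ hij hi hj]
    exact mul_mem (mul_mem (mem i hi₀ hi) (mem j hj₀ hj)) (mem i hi₀ hi)

/-- Star presentation of the symmetric group: for `n ≥ 3`, the homomorphism
from `PresentedGroup (starRelators n)` to `Equiv.Perm (Fin n)` sending the
generator `y_k` to the transposition `Equiv.swap 0 k` is a group isomorphism. -/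
theorem star_presentation_symmetricGroup (n : ℕ) (hn : 3 ≤ n) :
    ∃ e : PresentedGroup (starRelators n) ≃* Equiv.Perm (Fin n),
      ∀ (k : ℕ) (h : 0 < k ∧ k < n),
        e (PresentedGroup.of ⟨k, h⟩) = Equiv.swap ⟨0, by omega⟩ ⟨k, h.2⟩ := by
  refine ⟨MulEquiv.ofBijective (starHom n) ⟨starHom_injective (by omega), starHom_surjective n⟩,
    fun k h => ?_⟩
  rw [← starGen_eq_of h, ← starSwap_of_lt h.2]
  exact starHom_starGen h.1 h.2
end

section
/- The star generators of the infinite symmetric group satisfy the square-root-of-free relations: for all natural numbers k, l with 0 < k < l, the identity γ_l · γ_{l−1} · (γ_{l−2} · γ_{l−3} ⋯ γ_{k+1} · γ_k) · γ_l = γ_{l−1} · (γ_{l−2} · γ_{l−3} ⋯ γ_{k+1} · γ_k) · γ_l · γ_{l−1} holds in Equiv.Perm ℕ, where the parenthesized product is taken over the indices l−2, l−3, …, k in decreasing order (and is the empty product 1 when l = k+1). -/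
/-- The star generator `γ i = (0, i)` in the infinite symmetric group. -/
def starGamma (i : ℕ) : Equiv.Perm ℕ := Equiv.swap 0 i

/-- The decreasing product `γ_{l-2} · γ_{l-3} ⋯ γ_{k+1} · γ_k`
(empty, i.e. `1`, when `l = k + 1`). -/
def starGammaDescProd (k l : ℕ) : Equiv.Perm ℕ :=
  ((List.range (l - 1 - k)).map fun t => starGamma (l - 2 - t)).prod

theorem starGamma_apply_of_ne {i m : ℕ} (h0 : m ≠ 0) (hi : m ≠ i) : starGamma i m = m :=
  Equiv.swap_apply_of_ne_of_ne h0 hi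

/-- A product of star generators fixes every nonzero point that is not one of the indices. -/
theorem prod_map_starGamma_apply_of_ne {α : Type*} (f : α → ℕ) (L : List α) {m : ℕ} (h0 : m ≠ 0)
    (h : ∀ t ∈ L, m ≠ f t) : (L.map fun t => starGamma (f t)).prod m = m := by
  induction L with
  | nil => rfl
  | cons a L ih =>
    rw [List.map_cons, List.prod_cons, Equiv.Perm.mul_apply,
      ih fun t ht => h t (List.mem_cons_of_mem a ht),
      starGamma_apply_of_ne h0 (h a List.mem_cons_self)]

theorem starGammaDescProd_apply_of_le {k l m : ℕ} (h0 : m ≠ 0) (hm : l - 1 ≤ m) :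
    starGammaDescProd k l m = m := by
  refine prod_map_starGamma_apply_of_ne (fun t => l - 2 - t) _ h0 fun t _ => ?_
  omega

/-- The star generators of `S_∞` satisfy the square-root-of-free relations. -/
theorem starGamma_sqrt_free_relations (k l : ℕ) (hk : 0 < k) (hkl : k < l) :
    starGamma l * starGamma (l - 1) * starGammaDescProd k l * starGamma l =
      starGamma (l - 1) * starGammaDescProd k l * starGamma l * starGamma (l - 1) := by
  set c := starGamma (l - 1) * starGammaDescProd k l with hc
  have hc_pred : c (l - 1) = 0 := by
    rw [hc, Equiv.Perm.mul_apply, starGammaDescProd_apply_of_le (by omega) le_rfl]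
    exact Equiv.swap_apply_right 0 (l - 1)
  have hc_self : c l = l := by
    rw [hc, Equiv.Perm.mul_apply, starGammaDescProd_apply_of_le (by omega) (by omega),
      starGamma_apply_of_ne (by omega) (by omega)]
  have conj_c : starGamma l * c = c * Equiv.swap (l - 1) l := by
    rw [Equiv.mul_swap_eq_swap_mul, hc_pred, hc_self, starGamma]
  have conj_gamma :
      starGamma l * starGamma (l - 1) = Equiv.swap (l - 1) l * starGamma l := by
    simp only [starGamma]
    rw [Equiv.mul_swap_eq_swap_mul, Equiv.swap_apply_left,
      Equiv.swap_apply_of_ne_of_ne (by omega) (by omega), Equiv.swap_comm l]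
  rw [mul_assoc (starGamma l), ← hc, conj_c, mul_assoc c, ← conj_gamma, mul_assoc c]
end

section
/- Disjoint cycles lie in star-generator subgroups over disjoint index sets (Lemma 1.4): let m ≥ 1 and let s_1, …, s_m ∈ Equiv.Perm ℕ be pairwise disjoint nontrivial cycles (each s_i satisfies Equiv.Perm.IsCycle and has a finite set of non-fixed points, and s_i, s_j are disjoint for i ≠ j). Then there exist pairwise disjoint finite subsets I_1, …, I_m ⊆ ℕ such that for each i, the permutation s_i belongs to the subgroup of Equiv.Perm ℕ generated by {γ_j : j ∈ I_i}. -/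
open Equiv in
/-- Star generators indexed by `S` generate every transposition of two elements of `S`. -/
theorem swap_mem_closure_starGamma {S : Set ℕ} {x y : ℕ} (hx : x ∈ S) (hy : y ∈ S) :
    swap x y ∈ Subgroup.closure (starGamma '' S) := by
  have hγ : ∀ z ∈ S, swap 0 z ∈ Subgroup.closure (starGamma '' S) := fun z hz =>
    Subgroup.subset_closure (Set.mem_image_of_mem starGamma hz)
  exact SubmonoidClass.swap_mem_trans _ (swap_comm 0 x ▸ hγ x hx) (hγ y hy)

open Equiv in
/-- A finitely supported permutation lies in the subgroup generated by the star generators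
indexed by its support. -/
theorem mem_closure_starGamma_support {f : Perm ℕ} (hf : {n | f n ≠ n}.Finite) :
    f ∈ Subgroup.closure (starGamma '' {n | f n ≠ n}) := by
  let T : Set (Perm ℕ) := {σ | ∃ x y, x ≠ y ∧ f x ≠ x ∧ f y ≠ y ∧ σ = swap x y}
  have hT : ∀ σ ∈ T, σ.IsSwap := fun σ ⟨x, y, hxy, _, _, h⟩ => ⟨x, y, hxy, h⟩
  have hle : Subgroup.closure T ≤ Subgroup.closure (starGamma '' {n | f n ≠ n}) := by
    rw [Subgroup.closure_le]
    rintro _ ⟨x, y, -, hx, hy, rfl⟩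
    exact swap_mem_closure_starGamma hx hy
  refine hle ((mem_closure_isSwap hT).2 ⟨hf, fun x => ?_⟩)
  rw [← swap_mem_closure_isSwap hT]
  rcases eq_or_ne (f x) x with h | h
  · simp [h, ← Perm.one_def]
  · exact Subgroup.subset_closure ⟨f x, x, h, fun h' => h (f.injective h'), h, rfl⟩

/-- Disjoint cycles lie in star-generator subgroups over disjoint index sets:
pairwise disjoint nontrivial finitely supported cycles `s 1, …, s m` lie in
subgroups generated by star generators `γ_j` over pairwise disjoint finite
index sets. -/
theorem disjoint_cycles_mem_starGamma_subgroups (m : ℕ) (hm : 1 ≤ m)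
    (s : Fin m → Equiv.Perm ℕ)
    (hcycle : ∀ i, (s i).IsCycle)
    (hfin : ∀ i, {n : ℕ | s i n ≠ n}.Finite)
    (hdisj : ∀ i j, i ≠ j → ∀ n : ℕ, s i n = n ∨ s j n = n) :
    ∃ I : Fin m → Finset ℕ,
      (∀ i j, i ≠ j → Disjoint (I i) (I j)) ∧
      ∀ i, s i ∈ Subgroup.closure ((fun j => starGamma j) '' (I i : Set ℕ)) := by
  refine ⟨fun i => (hfin i).toFinset, fun i j hij => ?_, fun i => ?_⟩
  · simp only [Finset.disjoint_left, Set.Finite.mem_toFinset, Set.mem_ofPred_eq]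
    exact fun n hi hj => (hdisj i j hij n).elim hi hj
  · rw [Set.Finite.coe_toFinset]
    exact mem_closure_starGamma_support (hfin i)
end

section
/- Conjugation of a cycle written in star generators (Lemma 1.5(ii)): let k ≥ 2, let n_1, …, n_k be pairwise distinct natural numbers with n_1 = 0 whenever 0 ∈ {n_1, …, n_k}, and let σ ∈ Equiv.Perm ℕ. If 0 ∉ {σ(n_1), …, σ(n_k)} then σ · (γ_{n_1} γ_{n_2} ⋯ γ_{n_k} γ_{n_1}) · σ⁻¹ = γ_{σ(n_1)} γ_{σ(n_2)} ⋯ γ_{σ(n_k)} γ_{σ(n_1)}. If σ(n_i) = 0 for some index i, then σ · (γ_{n_1} γ_{n_2} ⋯ γ_{n_k} γ_{n_1}) · σ⁻¹ = γ_{σ(n_i)} γ_{σ(n_{i+1})} ⋯ γ_{σ(n_k)} γ_{σ(n_1)} ⋯ γ_{σ(n_{i−1})} γ_{σ(n_i)} (a cyclic rotation of the word starting at position i). -/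
theorem List.formPerm_map_equiv_perm {α : Type*} [DecidableEq α] (σ : Equiv.Perm α) (l : List α) :
    (l.map σ).formPerm = σ * l.formPerm * σ⁻¹ := by
  induction l with
  | nil => simp
  | cons a t ih =>
    cases t with
    | nil => simp
    | cons b t =>
      rw [List.map_cons] at ih
      rw [List.map_cons, List.map_cons, List.formPerm_cons_cons, List.formPerm_cons_cons, ih,
        Equiv.swap_apply_apply]
      group

/-- Conjugation by `starGamma b` replaces the entry `0` of a cycle by `b`. -/
theorem formPerm_cons_eq_starGamma_conj {b : ℕ} {t : List ℕ} (h0 : 0 ∉ t) (hb : b ∉ t) :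
    (b :: t).formPerm = starGamma b * (0 :: t).formPerm * starGamma b := by
  have h : (0 :: t).map (starGamma b) = b :: t := by
    have ht : t.map (starGamma b) = t.map id := List.map_congr_left fun x hx =>
      Equiv.swap_apply_of_ne_of_ne (fun e => h0 (e ▸ hx)) (fun e => hb (e ▸ hx))
    rw [List.map_cons, ht, List.map_id]
    simp [starGamma]
  rw [← h, List.formPerm_map_equiv_perm]
  simp [starGamma]

theorem prod_map_starGamma {t : List ℕ} (h0 : 0 ∉ t) (ht : t.Nodup) :
    (t.map starGamma).prod = (0 :: t).formPerm⁻¹ := by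
  induction t with
  | nil => simp
  | cons b t ih =>
    rw [List.mem_cons, not_or] at h0
    rw [List.nodup_cons] at ht
    rw [List.map_cons, List.prod_cons, ih h0.2 ht.2, List.formPerm_cons_cons,
      formPerm_cons_eq_starGamma_conj h0.2 ht.1]
    simp [starGamma, mul_assoc]

/-- A nodup word in the star generators, closed up by repeating its first letter, is the inverse
of the cycle along its letters, provided `0` may occur only as the first letter. -/
theorem prod_map_starGamma_mul_head {l : List ℕ} (hl : l ≠ []) (hd : l.Nodup)
    (h0 : 0 ∈ l → l.head hl = 0) :
    (l.map starGamma).prod * starGamma (l.head hl) = l.formPerm⁻¹ := by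
  cases l with
  | nil => exact absurd rfl hl
  | cons a t =>
    rw [List.nodup_cons] at hd
    have ht : 0 ∉ t := fun h => hd.1 (by
      have ha : a = 0 := h0 (List.mem_cons_of_mem a h)
      rwa [ha])
    rw [List.head_cons, List.map_cons, List.prod_cons, prod_map_starGamma ht hd.2,
      formPerm_cons_eq_starGamma_conj ht hd.1]
    simp [starGamma, mul_assoc]

theorem prod_ofFn_starGamma_mul {k : ℕ} (hk : 0 < k) {n : Fin k → ℕ}
    (hinj : Function.Injective n) (h0 : (∃ j, n j = 0) → n ⟨0, hk⟩ = 0) :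
    (List.ofFn fun j => starGamma (n j)).prod * starGamma (n ⟨0, hk⟩) =
      (List.ofFn n).formPerm⁻¹ := by
  have hl : List.ofFn n ≠ [] := by simpa [List.ofFn_eq_nil_iff] using hk.ne'
  have hh : (List.ofFn n).head hl = n ⟨0, hk⟩ := by simp [List.head_eq_getElem]
  have h := prod_map_starGamma_mul_head hl (List.nodup_ofFn.2 hinj)
    (fun h => hh.trans (h0 (by simpa [List.mem_ofFn] using h)))
  rwa [hh, List.map_ofFn] at h

theorem List.ofFn_add_left_eq_rotate {α : Type*} {k : ℕ} (f : Fin k → α) (i : Fin k) :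
    List.ofFn (fun j => f (i + j)) = (List.ofFn f).rotate i := by
  refine List.ext_getElem (by simp) fun m h₁ h₂ => ?_
  simp [List.getElem_rotate, Fin.add_def, add_comm]

/-- Conjugation of a cycle written in star generators: for `k ≥ 2`, pairwise
distinct `n 0, …, n (k-1)` (with `n 0 = 0` whenever `0` occurs among them) and
`σ ∈ Perm ℕ`, if `0` is not among the `σ (n j)` then
`σ (γ_{n 0} γ_{n 1} ⋯ γ_{n (k-1)} γ_{n 0}) σ⁻¹ =
  γ_{σ (n 0)} γ_{σ (n 1)} ⋯ γ_{σ (n (k-1))} γ_{σ (n 0)}`,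
while if `σ (n i) = 0` then the conjugate is the cyclic rotation of the word
starting at position `i`. -/
theorem conj_starGamma_cycle (k : ℕ) (hk : 2 ≤ k) (n : Fin k → ℕ)
    (hinj : Function.Injective n)
    (h0 : (∃ j, n j = 0) → n ⟨0, by omega⟩ = 0)
    (σ : Equiv.Perm ℕ) :
    ((∀ j, σ (n j) ≠ 0) →
      σ * ((List.ofFn fun j => starGamma (n j)).prod * starGamma (n ⟨0, by omega⟩)) * σ⁻¹ =
        (List.ofFn fun j => starGamma (σ (n j))).prod * starGamma (σ (n ⟨0, by omega⟩))) ∧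
    (∀ i : Fin k, σ (n i) = 0 →
      σ * ((List.ofFn fun j => starGamma (n j)).prod * starGamma (n ⟨0, by omega⟩)) * σ⁻¹ =
        (List.ofFn fun j => starGamma (σ (n (i + j)))).prod * starGamma (σ (n i))) := by
  have hk0 : 0 < k := by omega
  have hσ : Function.Injective fun j => σ (n j) := σ.injective.comp hinj
  have hconj : σ * ((List.ofFn fun j => starGamma (n j)).prod * starGamma (n ⟨0, hk0⟩)) * σ⁻¹ =
      (List.ofFn fun j => σ (n j)).formPerm⁻¹ := by
    have hmap : (List.ofFn fun j => σ (n j)) = (List.ofFn n).map σ := by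
      rw [List.map_ofFn]
      rfl
    rw [prod_ofFn_starGamma_mul hk0 hinj h0, hmap, List.formPerm_map_equiv_perm]
    group
  refine ⟨fun h => ?_, fun i hi => ?_⟩
  · rw [hconj, prod_ofFn_starGamma_mul hk0 hσ fun ⟨j, hj⟩ => absurd hj (h j)]
  · have : NeZero k := ⟨hk0.ne'⟩
    have hi0 : i + ⟨0, hk0⟩ = i := add_zero i
    have hrot := prod_ofFn_starGamma_mul hk0 (n := fun j => σ (n (i + j)))
      (hσ.comp (add_right_injective i)) (fun _ => by rw [hi0, hi])
    rw [hi0] at hrot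
    rw [hconj, hrot, List.ofFn_add_left_eq_rotate (fun j => σ (n j)),
      List.formPerm_rotate _ (List.nodup_ofFn.2 hσ)]
end

section
/- The partial shift is conjugation by a cycle of Coxeter generators (Lemma 1.6, second part): let m ∈ ℕ, let τ ∈ Equiv.Perm ℕ, and let n > m be such that τ(k) = k for every k ≥ n. Then sh_m(τ) = (σ_{m+1} · σ_{m+2} ⋯ σ_{n−1} · σ_n) · τ · (σ_n · σ_{n−1} ⋯ σ_{m+2} · σ_{m+1}) in Equiv.Perm ℕ. -/
/-- The Coxeter generator `σ_i = (i-1, i)` (with `σ_0 = 1`). -/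
def coxGen (i : ℕ) : Equiv.Perm ℕ := Equiv.swap (i - 1) i

/-- The underlying permutation of the shift `sh`: it fixes `0` and sends
`k + 1` to `τ k + 1`. -/
def shPerm (τ : Equiv.Perm ℕ) : Equiv.Perm ℕ where
  toFun n := match n with
    | 0 => 0
    | k + 1 => τ k + 1
  invFun n := match n with
    | 0 => 0
    | k + 1 => τ.symm k + 1
  left_inv n := by cases n <;> simp
  right_inv n := by cases n <;> simp

/-- The shift `sh : Perm ℕ →* Perm ℕ` determined by `(sh τ) 0 = 0` and
`(sh τ) (k+1) = τ k + 1`; it satisfies `sh (σ_i) = σ_{i+1}`. -/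
def sh : Equiv.Perm ℕ →* Equiv.Perm ℕ where
  toFun := shPerm
  map_one' := by ext n; cases n <;> rfl
  map_mul' σ τ := by ext n; cases n <;> rfl

/-- The descending product `σ_m · σ_{m-1} ⋯ σ_1`. -/
def coxDescProd (m : ℕ) : Equiv.Perm ℕ :=
  ((List.range m).map fun t => coxGen (m - t)).prod

/-- The ascending product `σ_1 · σ_2 ⋯ σ_m`. -/
def coxAscProd (m : ℕ) : Equiv.Perm ℕ :=
  ((List.range m).map fun t => coxGen (t + 1)).prod

/-- The `m`-shift `sh_m (τ) = σ_m σ_{m-1} ⋯ σ_1 · sh(τ) · σ_1 ⋯ σ_{m-1} σ_m`. -/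
def shm (m : ℕ) (τ : Equiv.Perm ℕ) : Equiv.Perm ℕ :=
  coxDescProd m * sh τ * coxAscProd m

/-- The ascending product `σ_{m+1} · σ_{m+2} ⋯ σ_{m+r}`. -/
def coxProd (m r : ℕ) : Equiv.Perm ℕ :=
  ((List.range r).map fun t => coxGen (m + 1 + t)).prod

lemma coxGen_inv (i : ℕ) : (coxGen i)⁻¹ = coxGen i := Equiv.swap_inv _ _

lemma coxProd_succ (m r : ℕ) : coxProd m (r + 1) = coxProd m r * coxGen (m + 1 + r) := by
  simp [coxProd, List.range_succ]

lemma coxProd_mul (m r s : ℕ) : coxProd m r * coxProd (m + r) s = coxProd m (r + s) := by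
  induction s with
  | zero => simp [coxProd]
  | succ s ih =>
    rw [coxProd_succ, ← mul_assoc, ih, ← Nat.add_assoc, coxProd_succ]
    congr 2
    omega

lemma coxProd_inv (m r : ℕ) :
    (coxProd m r)⁻¹ = ((List.range r).map fun t => coxGen (m + r - t)).prod := by
  induction r with
  | zero => simp [coxProd]
  | succ r ih =>
    rw [coxProd_succ, mul_inv_rev, coxGen_inv, ih, List.range_succ_eq_map, List.map_cons,
      List.prod_cons, List.map_map]
    congr 2
    · omega
    · refine List.map_congr_left fun t _ => ?_
      simp only [Function.comp_apply]
      congr 1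
      omega

lemma coxAscProd_eq_coxProd (m : ℕ) : coxAscProd m = coxProd 0 m := by
  simp [coxAscProd, coxProd, Nat.add_comm]

lemma coxDescProd_eq_inv_coxProd (m : ℕ) : coxDescProd m = (coxProd 0 m)⁻¹ := by
  simp [coxDescProd, coxProd_inv]

lemma coxProd_zero_apply (r k : ℕ) :
    coxProd 0 r k = if k < r then k + 1 else if k = r then 0 else k := by
  induction r generalizing k with
  | zero => simp +contextual [coxProd]
  | succ r ih =>
    rw [coxProd_succ, Equiv.Perm.mul_apply, ih, coxGen, Equiv.swap_apply_def]
    grind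

@[simp] lemma sh_apply_zero (τ : Equiv.Perm ℕ) : sh τ 0 = 0 := rfl

@[simp] lemma sh_apply_succ (τ : Equiv.Perm ℕ) (k : ℕ) : sh τ (k + 1) = τ k + 1 := rfl

/-- If `τ` fixes every `k ≥ n`, then `σ_1 ⋯ σ_n` conjugates `τ` to its shift. -/
lemma sh_mul_coxProd (τ : Equiv.Perm ℕ) (n : ℕ) (hfix : ∀ k, n ≤ k → τ k = k) :
    sh τ * coxProd 0 n = coxProd 0 n * τ := by
  ext k
  rw [Equiv.Perm.mul_apply, Equiv.Perm.mul_apply, coxProd_zero_apply, coxProd_zero_apply]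
  rcases lt_trichotomy k n with h | rfl | h
  · have hτ : τ k < n := by
      by_contra! hn
      have := τ.injective (hfix _ hn)
      omega
    simp [h, hτ]
  · simp [hfix k le_rfl]
  · obtain ⟨j, rfl⟩ := Nat.exists_eq_succ_of_ne_zero (Nat.ne_zero_of_lt h)
    simp [hfix _ h.le, hfix j (Nat.le_of_lt_succ h), h.ne', h.not_gt]

/-- The partial shift is conjugation by a cycle of Coxeter generators: if
`τ` fixes every `k ≥ n` and `m < n`, then
`sh_m (τ) = (σ_{m+1} σ_{m+2} ⋯ σ_n) · τ · (σ_n σ_{n-1} ⋯ σ_{m+1})`. -/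
theorem shm_eq_conj_coxProd (m : ℕ) (τ : Equiv.Perm ℕ) (n : ℕ) (hmn : m < n)
    (hfix : ∀ k, n ≤ k → τ k = k) :
    shm m τ =
      ((List.range (n - m)).map fun t => coxGen (m + 1 + t)).prod * τ *
        ((List.range (n - m)).map fun t => coxGen (n - t)).prod := by
  obtain ⟨r, rfl⟩ := Nat.exists_eq_add_of_le hmn.le
  rw [Nat.add_sub_cancel_left, ← coxProd_inv, ← coxProd, shm, coxAscProd_eq_coxProd,
    coxDescProd_eq_inv_coxProd, eq_mul_inv_iff_mul_eq, mul_assoc, mul_assoc,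
    inv_mul_eq_iff_eq_mul, ← mul_assoc (coxProd 0 m) (coxProd m r)]
  have hmul := coxProd_mul 0 m r
  rw [Nat.zero_add] at hmul
  rw [hmul]
  exact sh_mul_coxProd τ (m + r) hfix
end

section
/- Action of the partial shifts on Coxeter generators (proof of Lemma 1.7): for every m ∈ ℕ and every i ≥ 1, sh_m(σ_i) = σ_i if i < m, sh_m(σ_i) = σ_m · σ_{m+1} · σ_m if i = m ≥ 1, and sh_m(σ_i) = σ_{i+1} if i > m. -/
theorem coxDescProd_succ (m : ℕ) : coxDescProd (m + 1) = coxGen (m + 1) * coxDescProd m := by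
  simp [coxDescProd, List.range_succ_eq_map, Function.comp_def]

theorem coxAscProd_succ (m : ℕ) : coxAscProd (m + 1) = coxAscProd m * coxGen (m + 1) := by
  simp [coxAscProd, List.range_succ]

theorem coxAscProd_eq_inv (m : ℕ) : coxAscProd m = (coxDescProd m)⁻¹ := by
  induction m with
  | zero => simp [coxAscProd, coxDescProd]
  | succ m ih => rw [coxAscProd_succ, coxDescProd_succ, mul_inv_rev, ih, coxGen, Equiv.swap_inv]

/-- The descending product is the cycle `0 ↦ m`, `k ↦ k - 1` for `1 ≤ k ≤ m`. -/
theorem coxDescProd_apply (m n : ℕ) :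
    coxDescProd m n = if n = 0 then m else if n ≤ m then n - 1 else n := by
  induction m with
  | zero => by_cases hn : n = 0 <;> simp [coxDescProd, hn]
  | succ m ih =>
    rw [coxDescProd_succ, Equiv.Perm.mul_apply, ih, coxGen, Equiv.swap_apply_def]
    split_ifs <;> omega

theorem sh_swap (a b : ℕ) : sh (Equiv.swap a b) = Equiv.swap (a + 1) (b + 1) := by
  ext n
  cases n with
  | zero =>
    rw [Equiv.swap_apply_of_ne_of_ne (by omega) (by omega)]
    rfl
  | succ k =>
    change Equiv.swap a b k + 1 = _
    simp only [Equiv.swap_apply_def]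
    split_ifs <;> omega

theorem shm_swap (m a b : ℕ) :
    shm m (Equiv.swap a b) =
      Equiv.swap (coxDescProd m (a + 1)) (coxDescProd m (b + 1)) := by
  rw [shm, sh_swap, coxAscProd_eq_inv, Equiv.swap_apply_apply]

/-- Action of the partial shifts on Coxeter generators:
`sh_m (σ_i) = σ_i` if `i < m`, `sh_m (σ_m) = σ_m σ_{m+1} σ_m` (for `m ≥ 1`),
and `sh_m (σ_i) = σ_{i+1}` if `i > m`. -/
theorem shm_coxGen (m i : ℕ) (hi : 1 ≤ i) :
    (i < m → shm m (coxGen i) = coxGen i) ∧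
    (i = m → shm m (coxGen i) = coxGen m * coxGen (m + 1) * coxGen m) ∧
    (m < i → shm m (coxGen i) = coxGen (i + 1)) := by
  obtain ⟨i, rfl⟩ : ∃ k, i = k + 1 := ⟨i - 1, by omega⟩
  rw [coxGen, Nat.add_sub_cancel, shm_swap]
  refine ⟨fun h => ?_, fun h => ?_, fun h => ?_⟩
  · rw [show coxDescProd m (i + 1) = i by rw [coxDescProd_apply]; grind,
      show coxDescProd m (i + 1 + 1) = i + 1 by rw [coxDescProd_apply]; grind]
  · subst h
    rw [show coxDescProd (i + 1) (i + 1) = i by rw [coxDescProd_apply]; grind,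
      show coxDescProd (i + 1) (i + 1 + 1) = i + 2 by rw [coxDescProd_apply]; grind,
      coxGen, coxGen, Nat.add_sub_cancel, Nat.add_sub_cancel, Equiv.swap_comm i (i + 1),
      Equiv.swap_comm (i + 1) (i + 1 + 1),
      Equiv.swap_mul_swap_mul_swap (by omega) (by omega)]
  · rw [show coxDescProd m (i + 1) = i + 1 by rw [coxDescProd_apply]; grind,
      show coxDescProd m (i + 1 + 1) = i + 1 + 1 by rw [coxDescProd_apply]; grind,
      coxGen, Nat.add_sub_cancel]
end

section
/- The Thoma function is positive definite on each finite symmetric group (existence direction of Thoma's theorem, finite level): let a, b : ℕ → ℝ be summable sequences with a_i ≥ 0, b_j ≥ 0 and ∑'_i a_i + ∑'_j b_j ≤ 1, and for k ≥ 2 set s_k := ∑'_i (a_i)^k + (−1)^{k−1} · ∑'_j (b_j)^k. For n ∈ ℕ define χ : Equiv.Perm (Fin n) → ℝ by χ(σ) := ∏_{k ∈ σ.cycleType} s_k (the product over the multiset Equiv.Perm.cycleType σ of cycle lengths of σ; in particular χ(1) = 1). Then χ is positive definite: for every c : Equiv.Perm (Fin n) → ℂ, the sum ∑_{σ,τ}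 (starRingEnd ℂ)(c σ) · (c τ) · χ(σ⁻¹ · τ) is a nonnegative real number. -/
open Equiv.Perm

open scoped ComplexOrder

/-- A real function on a finite group is positive definite if all its Gram-type sums are
nonnegative. -/
def PosDefOnGroup {G : Type*} [Group G] [Fintype G] (f : G → ℝ) : Prop :=
  ∀ c : G → ℂ, 0 ≤ ∑ σ, ∑ τ, (starRingEnd ℂ) (c σ) * c τ * (f (σ⁻¹ * τ) : ℂ)

namespace PosDefOnGroup

variable {G : Type*} [Group G] [Fintype G]

/-- A quadratic character of a subgroup, extended by zero, is positive definite. -/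
theorem of_mul_mul {f : G → ℝ} (hf : ∀ g x, f g * f (g * x) = f g ^ 2 * f x)
    (hne : f ≠ 0) : PosDefOnGroup f := by
  intro c
  have hpos : 0 < ∑ g, f g ^ 2 := by
    obtain ⟨g, hg⟩ := Function.ne_iff.1 hne
    exact Finset.sum_pos' (fun _ _ => sq_nonneg _)
      ⟨g, Finset.mem_univ _, by simpa using pow_pos (abs_pos.2 hg) 2⟩
  have key : ∀ σ τ : G, ∑ g, f (g * σ) * f (g * τ) = (∑ g, f g ^ 2) * f (σ⁻¹ * τ) := by
    intro σ τ
    rw [Finset.sum_mul, ← Equiv.sum_comp (Equiv.mulRight σ) (fun g => f g ^ 2 * f (σ⁻¹ * τ))]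
    refine Finset.sum_congr rfl fun g _ => ?_
    rw [Equiv.coe_mulRight, ← hf]
    simp [mul_assoc]
  have hsq : ((∑ g, f g ^ 2 : ℝ) : ℂ) *
      ∑ σ, ∑ τ, (starRingEnd ℂ) (c σ) * c τ * (f (σ⁻¹ * τ) : ℂ) =
      ∑ g, (starRingEnd ℂ) (∑ σ, c σ * f (g * σ)) * ∑ τ, c τ * f (g * τ) := by
    simp only [map_sum, Finset.sum_mul_sum, map_mul, Complex.conj_ofReal]
    refine .trans ?_ Finset.sum_comm
    rw [Finset.mul_sum]
    refine Finset.sum_congr rfl fun σ _ => .trans ?_ Finset.sum_comm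
    rw [Finset.mul_sum]
    refine Finset.sum_congr rfl fun τ _ => ?_
    rw [mul_left_comm, ← Complex.ofReal_mul, ← key, Complex.ofReal_sum, Finset.mul_sum]
    refine Finset.sum_congr rfl fun g _ => ?_
    push_cast
    ring
  have hnn : 0 ≤ ((∑ g, f g ^ 2 : ℝ) : ℂ) *
      ∑ σ, ∑ τ, (starRingEnd ℂ) (c σ) * c τ * (f (σ⁻¹ * τ) : ℂ) := by
    rw [hsq]
    exact Finset.sum_nonneg fun g _ => star_mul_self_nonneg _
  rw [← inv_mul_cancel_left₀ (Complex.ofReal_ne_zero.2 hpos.ne') (∑ σ, ∑ τ, _),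
    ← Complex.ofReal_inv]
  exact mul_nonneg (Complex.zero_le_real.2 (inv_nonneg.2 hpos.le)) hnn

theorem sum {ι : Type*} {s : Finset ι} {f : ι → G → ℝ} {q : ι → ℝ}
    (hq : ∀ i ∈ s, 0 ≤ q i) (hf : ∀ i ∈ s, PosDefOnGroup (f i)) :
    PosDefOnGroup fun g => ∑ i ∈ s, q i * f i g := by
  intro c
  have : ∑ σ, ∑ τ, (starRingEnd ℂ) (c σ) * c τ * ((∑ i ∈ s, q i * f i (σ⁻¹ * τ) : ℝ) : ℂ) =
      ∑ i ∈ s, (q i : ℂ) *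
        ∑ σ, ∑ τ, (starRingEnd ℂ) (c σ) * c τ * (f i (σ⁻¹ * τ) : ℂ) := by
    simp only [Complex.ofReal_sum, Complex.ofReal_mul, Finset.mul_sum]
    rw [Finset.sum_comm' (t' := Finset.univ) (s' := fun _ => s) (by simp)]
    refine Finset.sum_congr rfl fun σ _ => ?_
    rw [Finset.sum_comm]
    refine Finset.sum_congr rfl fun τ _ => Finset.sum_congr rfl fun i _ => ?_
    ring
  rw [this]
  exact Finset.sum_nonneg fun i hi =>
    mul_nonneg (by exact_mod_cast hq i hi) (hf i hi c)

theorem of_tendsto {f : ℕ → G → ℝ} {g : G → ℝ} (hf : ∀ N, PosDefOnGroup (f N))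
    (h : ∀ σ, Filter.Tendsto (fun N => f N σ) Filter.atTop (nhds (g σ))) :
    PosDefOnGroup g := by
  intro c
  refine ge_of_tendsto' (tendsto_finsetSum _ fun σ _ => tendsto_finsetSum _ fun τ _ =>
    ((Complex.continuous_ofReal.tendsto _).comp (h (σ⁻¹ * τ))).const_mul _) fun N => hf N c

end PosDefOnGroup

section Coloring

variable {α ι : Type*} [Fintype α] [DecidableEq α] [DecidableEq ι]

/-- For a permutation `σ` preserving the coloring `w`, the sign of its restriction to the points
of odd color; zero if `σ` does not preserve `w`. -/
noncomputable def coloringSign (odd : ι → Prop) [DecidablePred odd] (w : α → ι)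
    (σ : Equiv.Perm α) : ℝ :=
  if h : ∀ x, w (σ x) = w x then
    ((sign (σ.subtypePerm (p := fun x => odd (w x)) fun x => by rw [h x]) : ℤ) : ℝ)
  else 0

variable (odd : ι → Prop) [DecidablePred odd]


theorem coloringSign_one (w : α → ι) : coloringSign odd w 1 = 1 := by
  simp only [coloringSign, one_apply, implies_true, dite_true]
  rw [subtypePerm_one, map_one, Units.val_one, Int.cast_one]

theorem coloringSign_mul {w : α → ι} {σ : Equiv.Perm α} (hσ : ∀ x, w (σ x) = w x)
    (τ : Equiv.Perm α) :
    coloringSign odd w (σ * τ) = coloringSign odd w σ * coloringSign odd w τ := by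
  by_cases hτ : ∀ x, w (τ x) = w x
  · have hστ : ∀ x, w ((σ * τ) x) = w x := fun x => by rw [mul_apply, hσ, hτ]
    simp only [coloringSign, dif_pos hσ, dif_pos hτ, dif_pos hστ]
    rw [← Int.cast_mul, ← Units.val_mul, ← Equiv.Perm.sign_mul, subtypePerm_mul]
  · have hστ : ¬ ∀ x, w ((σ * τ) x) = w x := fun h => hτ fun x => by
      rw [← hσ, ← mul_apply, h]
    simp only [coloringSign, dif_neg hτ, dif_neg hστ, mul_zero]

theorem coloringSign_posDef (w : α → ι) : PosDefOnGroup (coloringSign odd w) := by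
  refine .of_mul_mul (fun g x => ?_) fun h => ?_
  · by_cases hg : ∀ x, w (g x) = w x
    · rw [coloringSign_mul odd hg]; ring
    · rw [show coloringSign odd w g = 0 from dif_neg hg]; simp
  · simpa [coloringSign_one] using congrFun h 1

theorem coloringSign_mul_of_disjoint {σ τ : Equiv.Perm α} (h : σ.Disjoint τ) (w : α → ι) :
    coloringSign odd w (σ * τ) = coloringSign odd w σ * coloringSign odd w τ := by
  by_cases hσ : ∀ x, w (σ x) = w x
  · exact coloringSign_mul odd hσ τ
  · have hστ : ¬ ∀ x, w ((σ * τ) x) = w x := fun hw => hσ fun x => by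
      rcases h x with hx | hx
      · rw [hx]
      · rw [← hw x, mul_apply, hx]
    simp only [coloringSign, dif_neg hσ, dif_neg hστ, zero_mul]

theorem coloringSign_eq_sign {w : α → ι} {σ π : Equiv.Perm α} (hσ : ∀ x, w (σ x) = w x)
    (hπ : ∀ x, π x = if odd (w x) then σ x else x) :
    coloringSign odd w σ = ((sign π : ℤ) : ℝ) := by
  rw [coloringSign, dif_pos hσ, ← sign_ofSubtype]
  congr 3
  ext x
  rw [hπ]
  split_ifs with hx
  · rw [ofSubtype_apply_of_mem (p := fun x => odd (w x)) _ hx]; rfl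
  · rw [ofSubtype_apply_of_not_mem (p := fun x => odd (w x)) _ hx]

theorem coloringSign_congr {σ : Equiv.Perm α} {w w' : α → ι}
    (h : ∀ x ∈ σ.support, w x = w' x) : coloringSign odd w σ = coloringSign odd w' σ := by
  have hiff : (∀ x, w (σ x) = w x) ↔ ∀ x, w' (σ x) = w' x := by
    refine forall_congr' fun x => ?_
    by_cases hx : x ∈ σ.support
    · rw [h x hx, h _ (apply_mem_support.2 hx)]
    · rw [notMem_support.1 hx]; simp
  by_cases hw : ∀ x, w (σ x) = w x
  · have hw' := hiff.1 hw
    rw [coloringSign_eq_sign odd hw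
      (π := ofSubtype (σ.subtypePerm (p := fun x => odd (w' x)) fun x => by rw [hw' x]))]
    · rw [sign_ofSubtype, coloringSign, dif_pos hw']
    · intro x
      by_cases hx : x ∈ σ.support
      · rw [h x hx]
        split_ifs with ho
        · rw [ofSubtype_apply_of_mem (p := fun x => odd (w' x)) _ ho]; rfl
        · rw [ofSubtype_apply_of_not_mem (p := fun x => odd (w' x)) _ ho]
      · have hfix := notMem_support.1 hx
        rw [hfix, ite_self]
        by_cases ho : odd (w' x)
        · rw [ofSubtype_apply_of_mem (p := fun x => odd (w' x)) _ ho]; exact hfix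
        · rw [ofSubtype_apply_of_not_mem (p := fun x => odd (w' x)) _ ho]
  · simp only [coloringSign, dif_neg hw, dif_neg (mt hiff.2 hw)]

theorem coloringSign_of_isCycle [Fintype ι] {σ : Equiv.Perm α} (hσ : σ.IsCycle) (w : α → ι) :
    coloringSign odd w σ = ∑ d, (if odd d then (-1) ^ (σ.support.card - 1) else 1) *
      ∏ x, if x ∈ σ.support then (if w x = d then 1 else 0) else (1 : ℝ) := by
  obtain ⟨x₀, hx₀, -⟩ := id hσ
  have hprod : ∀ d, (∏ x, if x ∈ σ.support then (if w x = d then 1 else 0) else (1 : ℝ)) =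
      if ∀ x ∈ σ.support, w x = d then 1 else 0 := by
    intro d
    rw [Finset.prod_ite_mem, Finset.univ_inter, Finset.prod_ite_zero]
    simp
  simp only [hprod]
  by_cases hw : ∀ x, w (σ x) = w x
  · have hconst : ∀ x ∈ σ.support, w x = w x₀ := by
      intro x hx
      obtain ⟨i, rfl⟩ := (hσ.exists_pow_eq hx₀ (mem_support.1 hx))
      clear hx
      induction i with
      | zero => rfl
      | succ i ih => rw [pow_succ', mul_apply, hw, ih]
    rw [Finset.sum_eq_single (w x₀) (fun d _ hd => by
        rw [if_neg (c := ∀ x ∈ σ.support, w x = d)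
          fun h => hd (h x₀ (mem_support.2 hx₀)).symm, mul_zero]) (by simp),
      if_pos hconst, mul_one]
    split_ifs with ho
    · rw [coloringSign_eq_sign odd hw (π := σ), hσ.sign]
      · obtain ⟨k, hk⟩ : ∃ k, σ.support.card = k + 1 :=
          ⟨_, (Nat.succ_pred_eq_of_pos (by have := hσ.two_le_card_support; omega)).symm⟩
        simp [hk, pow_succ]
      · intro x
        by_cases hx : x ∈ σ.support
        · rw [if_pos (by rwa [hconst x hx])]
        · rw [notMem_support.1 hx, ite_self]
    · rw [coloringSign_eq_sign odd hw (π := 1)]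
      · simp
      · intro x
        by_cases hx : x ∈ σ.support
        · rw [if_neg (by rwa [hconst x hx])]; rfl
        · rw [notMem_support.1 hx, ite_self]; rfl
  · rw [show coloringSign odd w σ = 0 from dif_neg hw]
    refine (Finset.sum_eq_zero fun d _ => ?_).symm
    rw [if_neg (c := ∀ x ∈ σ.support, w x = d), mul_zero]
    refine fun h => hw fun x => ?_
    by_cases hx : x ∈ σ.support
    · rw [h x hx, h _ (apply_mem_support.2 hx)]
    · rw [notMem_support.1 hx]

end Coloring

section ProductWeight

variable {α ι : Type*} [Fintype α] [DecidableEq α] [Fintype ι] [DecidableEq ι]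

omit [DecidableEq ι] in
/-- Functions of disjoint sets of coordinates are independent under a product weight. -/
theorem sum_prodWeight_mul_of_disjoint {q : ι → ℝ} (hq : ∑ d, q d = 1) (S : Finset α)
    {F H : (α → ι) → ℝ} (hF : ∀ w w', (∀ x ∈ S, w x = w' x) → F w = F w')
    (hH : ∀ w w', (∀ x, x ∉ S → w x = w' x) → H w = H w') :
    ∑ w : α → ι, (∏ x, q (w x)) * (F w * H w) =
      (∑ w : α → ι, (∏ x, q (w x)) * F w) * ∑ w : α → ι, (∏ x, q (w x)) * H w := by
  have hone : ∑ w : α → ι, ∏ x, q (w x) = 1 := by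
    rw [← Fintype.prod_sum fun (_ : α) d => q d]; simp [hq]
  let swapOutside : (α → ι) × (α → ι) → (α → ι) × (α → ι) := fun v =>
    (S.piecewise v.1 v.2, S.piecewise v.2 v.1)
  have hinv : Function.Involutive swapOutside := by
    rintro ⟨v, v'⟩
    ext x <;> by_cases hx : x ∈ S <;> simp [swapOutside, hx]
  calc ∑ w : α → ι, (∏ x, q (w x)) * (F w * H w)
      = ∑ v : (α → ι) × (α → ι),
          (∏ x, q (v.1 x)) * (F v.1 * H v.1) * ∏ x, q (v.2 x) := by
        rw [Fintype.sum_prod_type]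
        simp only [← Finset.mul_sum, hone, mul_one]
    _ = ∑ v : (α → ι) × (α → ι), (∏ x, q (v.1 x)) * F v.1 * ((∏ x, q (v.2 x)) * H v.2) := by
        rw [← Equiv.sum_comp hinv.toPerm]
        refine Finset.sum_congr rfl fun v _ => ?_
        have h1 : F (S.piecewise v.1 v.2) = F v.1 := hF _ _ fun x hx => by simp [hx]
        have h2 : H (S.piecewise v.1 v.2) = H v.2 := hH _ _ fun x hx => by simp [hx]
        have h3 : (∏ x, q (S.piecewise v.1 v.2 x)) * ∏ x, q (S.piecewise v.2 v.1 x) =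
            (∏ x, q (v.1 x)) * ∏ x, q (v.2 x) := by
          rw [← Finset.prod_mul_distrib, ← Finset.prod_mul_distrib]
          refine Finset.prod_congr rfl fun x _ => ?_
          by_cases hx : x ∈ S <;> simp [hx, mul_comm]
        simp only [Function.Involutive.coe_toPerm, swapOutside, h1, h2]
        linear_combination F v.1 * H v.2 * h3
    _ = _ := by
        rw [Fintype.sum_prod_type, Finset.sum_mul_sum]

variable (odd : ι → Prop) [DecidablePred odd]

theorem sum_prodWeight_mul_coloringSign {q : ι → ℝ} (hq : ∑ d, q d = 1) (σ : Equiv.Perm α) :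
    ∑ w : α → ι, (∏ x, q (w x)) * coloringSign odd w σ =
      (σ.cycleType.map fun k => ∑ d, (if odd d then (-1) ^ (k - 1) else 1) * q d ^ k).prod := by
  induction σ using cycle_induction_on with
  | base_one =>
    simp only [coloringSign_one, mul_one, cycleType_one, Multiset.map_zero, Multiset.prod_zero]
    rw [← Fintype.prod_sum fun (_ : α) d => q d]; simp [hq]
  | base_cycles σ hσ =>
    rw [hσ.cycleType, Multiset.map_singleton, Multiset.prod_singleton]
    simp only [coloringSign_of_isCycle odd hσ, Finset.mul_sum]
    rw [Finset.sum_comm]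
    refine Finset.sum_congr rfl fun d _ => ?_
    simp only [mul_left_comm (∏ x, q _), ← Finset.mul_sum, ← Finset.prod_mul_distrib]
    rw [← Fintype.prod_sum fun (x : α) e =>
      q e * if x ∈ σ.support then (if e = d then 1 else 0) else 1]
    congr 1
    have : ∀ x, (∑ e, q e * if x ∈ σ.support then (if e = d then 1 else 0) else 1) =
        if x ∈ σ.support then q d else 1 := by
      intro x
      split_ifs <;> simp [hq]
    simp only [this, Finset.prod_ite_mem, Finset.univ_inter, Finset.prod_const]
  | induction_disjoint σ τ h _ ihσ ihτ =>
    rw [h.cycleType_mul, Multiset.map_add, Multiset.prod_add, ← ihσ, ← ihτ]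
    simp only [coloringSign_mul_of_disjoint odd h]
    refine sum_prodWeight_mul_of_disjoint hq σ.support
      (fun _ _ hw => coloringSign_congr odd hw) fun _ _ hw => coloringSign_congr odd fun x hx =>
        hw x fun hx' => Finset.disjoint_left.1 h.disjoint_support hx' hx

theorem cycleType_powerSum_posDef {q : ι → ℝ} (hq : ∑ d, q d = 1) (hq0 : ∀ d, 0 ≤ q d) :
    PosDefOnGroup fun σ : Equiv.Perm α =>
      (σ.cycleType.map fun k => ∑ d, (if odd d then (-1) ^ (k - 1) else 1) * q d ^ k).prod := by
  simp only [← sum_prodWeight_mul_coloringSign odd hq]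
  exact .sum (fun w _ => Finset.prod_nonneg fun x _ => hq0 _) fun w _ =>
    coloringSign_posDef odd w

end ProductWeight

/-- Color weights truncating the Thoma parameters `a`, `b` at `N + 1`, with the missing mass spread
uniformly over `N + 1` further even colors. -/
noncomputable def thomaWeight (a b : ℕ → ℝ) (N : ℕ) :
    Fin (N + 1) ⊕ Fin (N + 1) ⊕ Fin (N + 1) → ℝ
  | .inl i => a i
  | .inr (.inl j) => b j
  | .inr (.inr _) =>
    (1 - ∑ i : Fin (N + 1), a i - ∑ j : Fin (N + 1), b j) / (N + 1)

/-- The colors carrying the parameters `b`. -/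
def thomaOdd (N : ℕ) : Fin (N + 1) ⊕ Fin (N + 1) ⊕ Fin (N + 1) → Bool
  | .inr (.inl _) => true
  | _ => false

section Thoma

variable {a b : ℕ → ℝ} (ha : ∀ i, 0 ≤ a i) (hb : ∀ j, 0 ≤ b j) (hsa : Summable a)
  (hsb : Summable b) (hsum : (∑' i, a i) + (∑' j, b j) ≤ 1)

theorem sum_thomaWeight (a b : ℕ → ℝ) (N : ℕ) : ∑ d, thomaWeight a b N d = 1 := by
  have : (N : ℝ) + 1 ≠ 0 := by positivity
  simp only [Fintype.sum_sum_type, thomaWeight, Finset.sum_const, Finset.card_univ,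
    Fintype.card_fin, nsmul_eq_mul]
  push_cast
  rw [mul_div_cancel₀ _ this]
  ring

include ha hb hsa hsb hsum in
theorem thoma_defect_nonneg (N : ℕ) :
    0 ≤ 1 - ∑ i : Fin (N + 1), a i - ∑ j : Fin (N + 1), b j := by
  have h1 := hsa.sum_le_tsum (Finset.range (N + 1)) fun i _ => ha i
  have h2 := hsb.sum_le_tsum (Finset.range (N + 1)) fun i _ => hb i
  rw [Finset.sum_range] at h1 h2
  linarith

theorem summable_pow_of_nonneg {u : ℕ → ℝ} (hu : ∀ i, 0 ≤ u i) (hs : Summable u)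
    {k : ℕ} (hk : k ≠ 0) : Summable fun i => u i ^ k := by
  refine .of_norm_bounded_eventually_nat hs ?_
  filter_upwards [hs.tendsto_atTop_zero.eventually_le_const one_pos] with i hi
  rw [Real.norm_of_nonneg (pow_nonneg (hu i) k)]
  exact pow_le_of_le_one (hu i) hi hk

include ha hb hsa hsb hsum in
theorem tendsto_thoma_powerSum {k : ℕ} (hk : 2 ≤ k) :
    Filter.Tendsto (fun N => ∑ d, (if thomaOdd N d then (-1) ^ (k - 1) else 1) *
      thomaWeight a b N d ^ k) Filter.atTop
      (nhds ((∑' i, a i ^ k) + (-1) ^ (k - 1) * ∑' j, b j ^ k)) := by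
  have hlim : ∀ {u : ℕ → ℝ}, (∀ i, 0 ≤ u i) → Summable u →
      Filter.Tendsto (fun N => ∑ i : Fin (N + 1), u i ^ k) Filter.atTop
        (nhds (∑' i, u i ^ k)) := by
    intro u hu hs
    have := (summable_pow_of_nonneg hu hs (by omega : k ≠ 0)).hasSum.tendsto_sum_nat
    simpa only [Finset.sum_range] using (Filter.tendsto_add_atTop_iff_nat 1).2 this
  have hrest : Filter.Tendsto (fun N : ℕ => ((N : ℝ) + 1) *
      ((1 - ∑ i : Fin (N + 1), a i - ∑ j : Fin (N + 1), b j) / (N + 1)) ^ k)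
      Filter.atTop (nhds 0) := by
    refine squeeze_zero (fun N => ?_) (fun N => ?_) tendsto_one_div_add_atTop_nhds_zero_nat
    · have := thoma_defect_nonneg ha hb hsa hsb hsum N
      positivity
    · have h0 := thoma_defect_nonneg ha hb hsa hsb hsum N
      have h1 : 1 - ∑ i : Fin (N + 1), a i - ∑ j : Fin (N + 1), b j ≤ 1 := by
        have h2 := Finset.sum_nonneg fun (i : Fin (N + 1)) (_ : i ∈ Finset.univ) => ha i
        have h3 := Finset.sum_nonneg fun (i : Fin (N + 1)) (_ : i ∈ Finset.univ) => hb i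
        linarith
      have hN : (0 : ℝ) < N + 1 := by positivity
      set t := (1 - ∑ i : Fin (N + 1), a i - ∑ j : Fin (N + 1), b j) / ((N : ℝ) + 1) with ht
      have ht0 : 0 ≤ t := by positivity
      have htN : t ≤ 1 / ((N : ℝ) + 1) := by rw [ht]; gcongr
      have ht1 : t ≤ 1 := htN.trans (by rw [div_le_one hN]; linarith [N.cast_nonneg (α := ℝ)])
      calc ((N : ℝ) + 1) * t ^ k ≤ (N + 1) * (1 / (N + 1)) ^ 2 := by
            gcongr
            exact (pow_le_pow_of_le_one ht0 ht1 hk).trans (by gcongr)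
        _ = 1 / (N + 1) := by field_simp
  have := ((hlim ha hsa).add ((hlim hb hsb).const_mul ((-1) ^ (k - 1)))).add hrest
  rw [add_zero] at this
  refine this.congr fun N => ?_
  simp [Fintype.sum_sum_type, thomaWeight, thomaOdd, Finset.mul_sum, add_assoc]

end Thoma

/-- The Thoma function is positive definite on each finite symmetric group:
with `s k = ∑ aᵢᵏ + (-1)^(k-1) ∑ bⱼᵏ` and `χ σ = ∏_{k ∈ cycleType σ} s k`,
every Gram-type sum `∑ (c σ)* (c τ) χ (σ⁻¹ τ)` is a nonnegative real. -/
theorem thoma_function_posDef (a b : ℕ → ℝ)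
    (ha : ∀ i, 0 ≤ a i) (hb : ∀ j, 0 ≤ b j)
    (hsa : Summable a) (hsb : Summable b)
    (hsum : (∑' i, a i) + (∑' j, b j) ≤ 1)
    (n : ℕ) (c : Equiv.Perm (Fin n) → ℂ) :
    ∃ r : ℝ, 0 ≤ r ∧
      (∑ σ : Equiv.Perm (Fin n), ∑ τ : Equiv.Perm (Fin n),
        (starRingEnd ℂ) (c σ) * c τ *
          ((((σ⁻¹ * τ).cycleType.map fun k =>
              (∑' i, (a i) ^ k) + (-1) ^ (k - 1) * ∑' j, (b j) ^ k).prod : ℝ) : ℂ))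
        = (r : ℂ) := by
  have hpd : PosDefOnGroup fun σ : Equiv.Perm (Fin n) => (σ.cycleType.map fun k =>
      (∑' i, (a i) ^ k) + (-1) ^ (k - 1) * ∑' j, (b j) ^ k).prod := by
    refine .of_tendsto (fun N => cycleType_powerSum_posDef (fun d => thomaOdd N d = true)
      (sum_thomaWeight a b N) ?_) fun σ => tendsto_multiset_prod _ fun k hk =>
        tendsto_thoma_powerSum ha hb hsa hsb hsum (two_le_of_mem_cycleType hk)
    have h0 := thoma_defect_nonneg ha hb hsa hsb hsum N
    rintro (i | j | _)
    · exact ha i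
    · exact hb j
    · exact div_nonneg h0 (by positivity)
  obtain ⟨hre, him⟩ := Complex.nonneg_iff.1 (hpd c)
  exact ⟨_, hre, Complex.ext rfl him.symm⟩
end

section
/- Fixed-point counting with product weights (trace formula of the tensor model, Section 8, positive part): let n, M ∈ ℕ, a : Fin M → ℝ, and σ ∈ Equiv.Perm (Fin n). Then ∑_{f} ∏_{j : Fin n} a(f(j)) = (∑_i a_i)^{n − |supp σ|} · ∏_{c ∈ σ.cycleFactorsFinset} (∑_i (a_i)^{|supp c|}), where the sum on the left runs over all functions f : Fin n → Fin M with f ∘ σ = f, |supp σ| denotes σ.support.card, and σ.cycleFactorsFinset is the finite set of cycles in the disjoint cycle decomposition of σ. -/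
section

open Finset Function

namespace Equiv.Perm

/-- Summing product weights over the functions that factor through a surjection `r` gives a
product of power sums, one for each fibre of `r`. -/
theorem sum_prod_comp_of_surjective {α β κ R : Type*} [Fintype α] [Fintype β] [Fintype κ]
    [DecidableEq κ] [CommSemiring R] (a : β → R) {r : α → κ}
    (hr : Surjective r) (s : Finset (α → β)) (hs : ∀ f, f ∈ s ↔ ∃ g : κ → β, g ∘ r = f) :
    ∑ f ∈ s, ∏ x, a (f x) = ∏ k, ∑ i, a i ^ #{x | r x = k} := by
  classical
  rw [Finset.prod_univ_sum, Fintype.piFinset_univ]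
  symm
  refine Finset.sum_nbij (fun g => g ∘ r) (fun g _ => (hs _).2 ⟨g, rfl⟩)
    (hr.injective_comp_right.injOn) (fun f hf => ?_) (fun g _ => ?_)
  · obtain ⟨g, hg⟩ := (hs f).1 hf
    exact ⟨g, by simp, hg⟩
  · simp only [comp_apply]
    rw [← Fintype.prod_fiberwise' r fun k => a (g k)]
    simp [Fintype.card_subtype]

variable {α : Type*} [Fintype α] [DecidableEq α]

/-- The orbit of a point under `σ`, recorded as the point itself when it is fixed and as its
cycle factor otherwise. -/
def orbitLabel (σ : Perm α) (x : α) : {x // x ∉ σ.support} ⊕ σ.cycleFactorsFinset :=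
  if h : x ∈ σ.support then .inr ⟨σ.cycleOf x, cycleOf_mem_cycleFactorsFinset_iff.2 h⟩
  else .inl ⟨x, h⟩

theorem orbitLabel_eq_inl_iff (σ : Perm α) (x : α) (y : {x // x ∉ σ.support}) :
    orbitLabel σ x = .inl y ↔ x = y := by
  obtain ⟨y, hy⟩ := y
  unfold orbitLabel
  split_ifs with h
  · simpa using fun e : x = y => hy (e ▸ h)
  · simp

theorem orbitLabel_eq_inr_iff (σ : Perm α) (x : α) (c : σ.cycleFactorsFinset) :
    orbitLabel σ x = .inr c ↔ x ∈ (c : Perm α).support := by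
  obtain ⟨c, hc⟩ := c
  rw [← eq_cycleOf_of_mem_cycleFactorsFinset_iff σ c hc x]
  unfold orbitLabel
  split_ifs with h
  · simp [eq_comm]
  · simp only [false_iff]
    rintro rfl
    exact h (cycleOf_mem_cycleFactorsFinset_iff.1 hc)

theorem orbitLabel_surjective (σ : Perm α) : Surjective (orbitLabel σ) := by
  rintro (y | c)
  · exact ⟨y, (orbitLabel_eq_inl_iff σ y y).2 rfl⟩
  · obtain ⟨x, hx⟩ := (mem_cycleFactorsFinset_iff.1 c.2).1.nonempty_support
    exact ⟨x, (orbitLabel_eq_inr_iff σ x c).2 hx⟩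

theorem orbitLabel_eq_iff_sameCycle (σ : Perm α) (x y : α) :
    orbitLabel σ x = orbitLabel σ y ↔ σ.SameCycle x y := by
  by_cases hy : y ∈ σ.support
  · rw [show orbitLabel σ y = .inr ⟨σ.cycleOf y, cycleOf_mem_cycleFactorsFinset_iff.2 hy⟩ from
      dif_pos hy, orbitLabel_eq_inr_iff, mem_support_cycleOf_iff' (mem_support.1 hy), sameCycle_comm]
  · rw [show orbitLabel σ y = .inl ⟨y, hy⟩ from dif_neg hy, orbitLabel_eq_inl_iff]
    exact ⟨fun h => h ▸ SameCycle.refl _ _,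
      fun h => (h.symm.eq_of_left (notMem_support.1 hy)).symm⟩

theorem comp_eq_self_iff_exists_comp_orbitLabel {β : Type*} (σ : Perm α) (f : α → β) :
    f ∘ σ = f ↔ ∃ g, g ∘ orbitLabel σ = f := by
  constructor
  · intro h
    refine ⟨f ∘ surjInv (orbitLabel_surjective σ), funext fun x => ?_⟩
    obtain ⟨i, hi⟩ := ((orbitLabel_eq_iff_sameCycle σ _ _).1
      (surjInv_eq (orbitLabel_surjective σ) (orbitLabel σ x))).exists_nat_pow_eq
    have hsemi : Semiconj f σ id := congrFun h
    have hpow := hsemi.iterate_right i (surjInv (orbitLabel_surjective σ) (orbitLabel σ x))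
    rw [iterate_id, ← coe_pow, hi] at hpow
    exact hpow.symm
  · rintro ⟨g, rfl⟩
    exact funext fun x => congrArg g
      ((orbitLabel_eq_iff_sameCycle σ _ _).2 (sameCycle_apply_left.2 (SameCycle.refl σ x)))

theorem sum_prod_of_comp_eq_self {β R : Type*} [Fintype β] [DecidableEq β] [CommSemiring R]
    (σ : Perm α) (a : β → R) :
    ∑ f : α → β with f ∘ σ = f, ∏ x, a (f x) =
      (∑ i, a i) ^ (Fintype.card α - #σ.support) *
        ∏ c ∈ σ.cycleFactorsFinset, ∑ i, a i ^ #c.support := by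
  rw [sum_prod_comp_of_surjective a (orbitLabel_surjective σ) _ fun f => by
    simp [comp_eq_self_iff_exists_comp_orbitLabel], Fintype.prod_sum_type]
  simp only [orbitLabel_eq_inl_iff, orbitLabel_eq_inr_iff, filter_univ_mem]
  congr 1
  · simp [Finset.filter_eq', Fintype.card_subtype_compl, -mem_support]
  · exact Finset.prod_coe_sort σ.cycleFactorsFinset fun c => ∑ i, a i ^ #c.support

end Equiv.Perm

end

/-- Fixed-point counting with product weights: for `σ ∈ Perm (Fin n)` and
weights `a : Fin M → ℝ`,
`∑_{f ∘ σ = f} ∏_j a (f j) =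
  (∑ i, a i)^(n - |supp σ|) · ∏_{c ∈ cycleFactors σ} ∑ i, (a i)^{|supp c|}`. -/
theorem fixedPoint_sum_prod_weights (n M : ℕ) (a : Fin M → ℝ)
    (σ : Equiv.Perm (Fin n)) :
    ∑ f ∈ Finset.univ.filter (fun f : Fin n → Fin M => f ∘ ⇑σ = f),
        ∏ j : Fin n, a (f j)
      = (∑ i, a i) ^ (n - σ.support.card) *
          ∏ c ∈ σ.cycleFactorsFinset, ∑ i, (a i) ^ (c.support.card) := by
  simpa using σ.sum_prod_of_comp_eq_self a
end

section
/- Signed fixed-point counting with product weights (trace formula of the tensor model, Section 8, general case): let n, M, N ∈ ℕ, a : Fin M → ℝ, b : Fin N → ℝ, and σ ∈ Equiv.Perm (Fin n). Define w : Fin M ⊕ Fin N → ℝ by w(inl i) = a_i and w(inr j) = b_j. For f : Fin n → (Fin M ⊕ Fin N) with f ∘ σ = f, the set T_f := {x : Fin n | f(x) is of the form inr j} is invariant under σ, and we write ε(f) ∈ {1, −1} for the sign of the permutation of T_f induced by σ (via Equiv.Perm.subtypePerm and Equiv.Perm.sign). Then ∑_{f : f ∘ σ = f} ε(f) · ∏_{j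 : Fin n} w(f(j)) = (∑_i a_i + ∑_j b_j)^{n − |supp σ|} · ∏_{c ∈ σ.cycleFactorsFinset} (∑_i (a_i)^{ℓ_c} + (−1)^{ℓ_c − 1} · ∑_j (b_j)^{ℓ_c}), where ℓ_c := c.support.card and |supp σ| := σ.support.card. -/
/-- For `f : Fin n → Fin M ⊕ Fin N` invariant under `σ` (`f ∘ σ = f`), the
sign of the permutation that `σ` induces on the set
`T_f = {x | f x is of the form inr j}` (which is `σ`-invariant). -/
def signOnRight {n M N : ℕ} (σ : Equiv.Perm (Fin n))
    (f : {f : Fin n → Fin M ⊕ Fin N // f ∘ ⇑σ = f}) : ℤ :=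
  Equiv.Perm.sign
    (σ.subtypePerm (p := fun x => (f.1 x).isRight = true)
      (fun x => by
        have hx : f.1 (σ x) = f.1 x := congrFun f.2 x
        simp only [hx]))

namespace Equiv.Perm

variable {α κ R : Type*} [Fintype α] [DecidableEq α]

/-- The sign of the restriction of `σ` to an invariant set is the product of the signs of the
cycle factors of `σ` lying in that set. -/
theorem sign_subtypePerm_eq_prod_cycleFactorsFinset (σ : Perm α) (p : α → Prop) [DecidablePred p]
    (hp : ∀ x, p (σ x) ↔ p x) (q : Perm α → Prop) [DecidablePred q]
    (hq : ∀ c ∈ σ.cycleFactorsFinset, ∀ x ∈ c.support, p x ↔ q c) :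
    sign (σ.subtypePerm hp) = ∏ c ∈ σ.cycleFactorsFinset, if q c then sign c else 1 := by
  induction σ using cycle_induction_on with
  | base_one =>
    have : (1 : Perm α).subtypePerm hp = 1 := rfl
    simp [this]
  | base_cycles σ hσ =>
    rw [hσ.cycleFactorsFinset_eq_singleton] at hq ⊢
    rw [Finset.prod_singleton]
    replace hq := hq σ (Finset.mem_singleton_self σ)
    split_ifs with h
    · exact sign_subtypePerm σ hp fun x hx ↦ (hq x (mem_support.2 hx)).2 h
    · have : σ.subtypePerm hp = 1 := by
        ext ⟨x, hx⟩
        by_contra hne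
        exact h ((hq x (mem_support.2 hne)).1 hx)
      rw [this, sign_one]
  | induction_disjoint σ τ hd _ hσ hτ =>
    have hpσ : ∀ x, p (σ x) ↔ p x := fun x ↦ by
      rcases hd x with hx | hx
      · rw [hx]
      · simpa [hx] using hp x
    have hpτ : ∀ x, p (τ x) ↔ p x := fun x ↦ by simpa [hpσ] using hp x
    have hmul : (σ * τ).subtypePerm hp = σ.subtypePerm hpσ * τ.subtypePerm hpτ := rfl
    rw [hd.cycleFactorsFinset_mul_eq_union] at hq ⊢
    rw [Finset.prod_union hd.disjoint_cycleFactorsFinset, hmul, sign_mul,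
      hσ hpσ fun c hc ↦ hq c (Finset.mem_union_left _ hc),
      hτ hpτ fun c hc ↦ hq c (Finset.mem_union_right _ hc)]

/-- The orbit of a point under `σ`: either a fixed point or a cycle factor. -/
def fixedPointOrCycle (σ : Perm α) (x : α) :
    Function.fixedPoints σ ⊕ σ.cycleFactorsFinset :=
  if h : σ x = x then .inl ⟨x, h⟩
  else .inr ⟨σ.cycleOf x, cycleOf_mem_cycleFactorsFinset_iff.2 (mem_support.2 h)⟩

theorem fixedPointOrCycle_eq_inl_iff {σ : Perm α} {x : α} {y : Function.fixedPoints σ} :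
    σ.fixedPointOrCycle x = .inl y ↔ x = y := by
  unfold fixedPointOrCycle
  split_ifs with h
  · simp [Subtype.ext_iff]
  · simp only [false_iff]
    rintro rfl
    exact h y.2

theorem fixedPointOrCycle_eq_inr_iff {σ : Perm α} {x : α} {c : σ.cycleFactorsFinset} :
    σ.fixedPointOrCycle x = .inr c ↔ x ∈ c.1.support := by
  unfold fixedPointOrCycle
  split_ifs with h
  · simp only [false_iff]
    exact fun hx ↦ mem_support.1 (mem_cycleFactorsFinset_support_le c.2 hx) h
  · rw [Sum.inr.injEq, Subtype.ext_iff]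
    refine ⟨fun hc ↦ hc ▸ mem_support_cycleOf_iff.2 ⟨.refl σ x, mem_support.2 h⟩, fun hx ↦ ?_⟩
    exact (cycle_is_cycleOf hx c.2).symm

theorem fixedPointOrCycle_surjective (σ : Perm α) : Function.Surjective σ.fixedPointOrCycle := by
  rintro (y | c)
  · exact ⟨y, fixedPointOrCycle_eq_inl_iff.2 rfl⟩
  · obtain ⟨x, hx⟩ := (mem_cycleFactorsFinset_iff.1 c.2).1.nonempty_support
    exact ⟨x, fixedPointOrCycle_eq_inr_iff.2 hx⟩

theorem fixedPointOrCycle_eq_iff {σ : Perm α} {x y : α} :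
    σ.fixedPointOrCycle x = σ.fixedPointOrCycle y ↔ σ.SameCycle x y := by
  by_cases hy : σ y = y
  · rw [fixedPointOrCycle, fixedPointOrCycle, dif_pos hy, ← fixedPointOrCycle,
      fixedPointOrCycle_eq_inl_iff]
    exact ⟨fun h ↦ h ▸ .refl σ x, fun h ↦ (h.symm.eq_of_left hy).symm⟩
  · nth_rw 2 [fixedPointOrCycle]
    rw [dif_neg hy, fixedPointOrCycle_eq_inr_iff, mem_support_cycleOf_iff' hy, sameCycle_comm]

/-- Functions on the orbits of `σ` are the same as `σ`-invariant functions. -/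
theorem bijective_comp_fixedPointOrCycle (σ : Perm α) :
    Function.Bijective (fun g : Function.fixedPoints σ ⊕ σ.cycleFactorsFinset → κ ↦
      (⟨g ∘ σ.fixedPointOrCycle, funext fun x ↦ congrArg g <|
        fixedPointOrCycle_eq_iff.2 (sameCycle_apply_left.2 (.refl σ x))⟩ :
        {f : α → κ // f ∘ σ = f})) := by
  refine ⟨fun g g' h ↦ σ.fixedPointOrCycle_surjective.injective_comp_right
    (congrArg Subtype.val h), fun ⟨f, hf⟩ ↦ ?_⟩
  obtain ⟨r, hr⟩ := σ.fixedPointOrCycle_surjective.hasRightInverse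
  have hf' : ∀ x y, σ.SameCycle x y → f x = f y := by
    rintro x y ⟨k, rfl⟩
    induction k with
    | zero => rfl
    | succ k ih => rw [add_comm, zpow_add, zpow_one, mul_apply, ih]; exact (congrFun hf _).symm
    | pred k ih =>
      rw [ih, ← congrFun hf ((σ ^ (-(k : ℤ) - 1)) x), Function.comp_apply, ← mul_apply,
        ← zpow_one_add, add_sub_cancel]
  exact ⟨f ∘ r, Subtype.ext <| funext fun x ↦ hf' _ _ (fixedPointOrCycle_eq_iff.1 (hr _))⟩

/-- The product over all points of a function constant on orbits. -/
theorem prod_comp_fixedPointOrCycle [CommMonoid R] (σ : Perm α)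
    (v : Function.fixedPoints σ ⊕ σ.cycleFactorsFinset → R) :
    ∏ x, v (σ.fixedPointOrCycle x) =
      (∏ y, v (.inl y)) * ∏ c, v (.inr c) ^ c.1.support.card := by
  rw [← Finset.prod_fiberwise' Finset.univ σ.fixedPointOrCycle v, Fintype.prod_sum_type]
  simp [fixedPointOrCycle_eq_inl_iff, fixedPointOrCycle_eq_inr_iff, Finset.filter_eq', -mem_support]

/-- Signed count of the `σ`-invariant functions `f`, weighted by `w`, the sign being that of the
restriction of `σ` to the points which `f` sends into `P`. -/
theorem sum_sign_subtypePerm_mul_prod [Fintype κ] [DecidableEq κ] [CommRing R] (σ : Perm α)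
    (w : κ → R) (P : κ → Prop) [DecidablePred P]
    (hP : ∀ f : {f : α → κ // f ∘ σ = f}, ∀ x, P (f.1 (σ x)) ↔ P (f.1 x)) :
    ∑ f : {f : α → κ // f ∘ σ = f},
        ((sign (σ.subtypePerm (p := fun x ↦ P (f.1 x)) (hP f)) : ℤ) : R) * ∏ x, w (f.1 x) =
      (∑ k, w k) ^ (Fintype.card α - σ.support.card) *
        ∏ c ∈ σ.cycleFactorsFinset,
          ∑ k, ((if P k then sign c else 1 : ℤˣ) : ℤ) * w k ^ c.support.card := by
  classical
  rw [← sum_cycleType, ← card_fixedPoints, ← Finset.card_univ, ← Finset.prod_const,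
    ← Finset.prod_coe_sort σ.cycleFactorsFinset, Finset.prod_univ_sum, Finset.prod_univ_sum,
    Fintype.piFinset_univ, Fintype.piFinset_univ, Finset.sum_mul_sum,
    ← Fintype.sum_prod_type',
    ← (bijective_comp_fixedPointOrCycle σ).sum_comp,
    ← (Equiv.sumArrowEquivProdArrow _ _ κ).sum_comp]
  refine Finset.sum_congr rfl fun g _ ↦ ?_
  have hsign (h) : sign (σ.subtypePerm (p := fun x ↦ P (g (σ.fixedPointOrCycle x))) h) =
      ∏ c : σ.cycleFactorsFinset, if P (g (.inr c)) then sign c.1 else 1 := by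
    rw [sign_subtypePerm_eq_prod_cycleFactorsFinset σ _ _
      (fun c ↦ ∃ h : c ∈ σ.cycleFactorsFinset, P (g (.inr ⟨c, h⟩)))]
    · rw [← Finset.prod_coe_sort]
      simp
    · intro c hc x hx
      have := (fixedPointOrCycle_eq_inr_iff (c := ⟨c, hc⟩)).2 hx
      simp [this, hc]
  have hprod := prod_comp_fixedPointOrCycle σ (fun i ↦ w (g i))
  simp only [Function.comp_apply]
  rw [hsign, hprod]
  simp only [Units.coe_prod, Int.cast_prod, Finset.prod_mul_distrib, sumArrowEquivProdArrow]
  rw [mul_left_comm]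
  rfl

end Equiv.Perm

/-- Signed fixed-point counting with product weights: with weights
`w = Sum.elim a b` and signs `ε f = signOnRight σ f`,
`∑_{f ∘ σ = f} ε f · ∏_j w (f j)
  = (∑ aᵢ + ∑ bⱼ)^(n - |supp σ|) ·
    ∏_{c ∈ cycleFactors σ} (∑ aᵢ^{ℓ_c} + (-1)^{ℓ_c - 1} ∑ bⱼ^{ℓ_c})`
where `ℓ_c = |supp c|`. -/
theorem signed_fixedPoint_sum_prod_weights (n M N : ℕ)
    (a : Fin M → ℝ) (b : Fin N → ℝ) (σ : Equiv.Perm (Fin n)) :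
    ∑ f : {f : Fin n → Fin M ⊕ Fin N // f ∘ ⇑σ = f},
        ((signOnRight σ f : ℤ) : ℝ) * ∏ j : Fin n, Sum.elim a b (f.1 j)
      = (∑ i, a i + ∑ j, b j) ^ (n - σ.support.card) *
          ∏ c ∈ σ.cycleFactorsFinset,
            (∑ i, (a i) ^ (c.support.card) +
              (-1) ^ (c.support.card - 1) * ∑ j, (b j) ^ (c.support.card)) := by
  have key := σ.sum_sign_subtypePerm_mul_prod (Sum.elim a b) (fun k ↦ k.isRight = true)
    (fun f x ↦ by rw [← Function.comp_apply (f := f.1), f.2])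
  rw [Fintype.card_fin] at key
  refine key.trans ?_
  congr 1
  · simp
  · refine Finset.prod_congr rfl fun c hc ↦ ?_
    have hc' := (Equiv.Perm.mem_cycleFactorsFinset_iff.1 hc).1
    obtain ⟨m, hm⟩ := Nat.exists_eq_add_of_le' (Nat.one_le_of_lt hc'.two_le_card_support)
    simp [hc'.sign, hm, pow_succ, Finset.mul_sum]
end

section
/- Discreteness of measures with a mass gap (key step of Proposition 6.1 and Theorem 6.2): let μ be a finite Borel measure on ℝ such that for every ε with 0 < ε < 1 and every Borel set B ⊆ {x : ℝ | ε ≤ |x|}, either μ(B) = 0 or ε² ≤ μ(B). Then (i) for every ε > 0 the set of atoms {x : ℝ | ε ≤ |x| and μ({x}) ≠ 0} is finite, and (ii) μ is discrete away from 0: there is a countable set D ⊆ ℝ with μ({x : ℝ | x ≠ 0 and x ∉ D}) = 0; hence the atoms of μ can only accumulate at 0. -/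
open MeasureTheory

/-- A finite measure has only finitely many points of mass at least `c > 0`. -/
theorem finite_setOf_le_measure_singleton {X : Type*} [MeasurableSpace X]
    [MeasurableSingletonClass X] (μ : Measure X) [IsFiniteMeasure μ] {c : ENNReal} (hc : 0 < c) :
    {x : X | c ≤ μ {x}}.Finite :=
  Measure.finite_const_le_meas_of_disjoint_iUnion μ hc (fun x => measurableSet_singleton x)
    (fun _ _ hxy => Set.disjoint_singleton.2 hxy) (measure_ne_top _ _)

/-- A finite measure has only countably many points of positive mass. -/
theorem countable_setOf_measure_singleton_ne_zero {X : Type*} [MeasurableSpace X]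
    [MeasurableSingletonClass X] (μ : Measure X) [IsFiniteMeasure μ] :
    {x : X | μ {x} ≠ 0}.Countable := by
  simpa only [pos_iff_ne_zero] using Measure.countable_meas_pos_of_disjoint_iUnion (μ := μ)
    (fun x : X => measurableSet_singleton x) (fun _ _ hxy => Set.disjoint_singleton.2 hxy)

/-- If every measurable subset of a measurable set `S` has mass `0` or at least `c > 0`, then `μ`
restricted to `S` is concentrated on the points of positive mass. -/
theorem measure_inter_setOf_singleton_eq_zero_of_gap {X : Type*} [TopologicalSpace X]
    [SecondCountableTopology X] [MeasurableSpace X] [OpensMeasurableSpace X]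
    (μ : Measure X) [μ.OuterRegular]
    {c : ENNReal} (hc : 0 < c) {S : Set X} (hS : MeasurableSet S)
    (h : ∀ B : Set X, MeasurableSet B → B ⊆ S → μ B = 0 ∨ c ≤ μ B) :
    μ (S ∩ {x | μ {x} = 0}) = 0 := by
  refine measure_null_of_locally_null _ fun x hx => ?_
  obtain ⟨U, hxU, hU, hμU⟩ := Set.exists_isOpen_lt_of_lt {x} c (hx.2.trans_lt hc)
  have hnull : μ (U ∩ S) = 0 :=
    (h _ (hU.measurableSet.inter hS) Set.inter_subset_right).resolve_right
      ((measure_mono Set.inter_subset_left).trans_lt hμU).not_ge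
  refine ⟨U ∩ (S ∩ {x | μ {x} = 0}), ?_, measure_mono_null
    (Set.inter_subset_inter_right U Set.inter_subset_left) hnull⟩
  exact Filter.inter_mem
    (mem_nhdsWithin_of_mem_nhds (hU.mem_nhds (hxU rfl))) self_mem_nhdsWithin

/-- Discreteness of measures with a mass gap: if a finite Borel measure `μ`
on `ℝ` gives every Borel subset of `{x | ε ≤ |x|}` (for `0 < ε < 1`) either
measure `0` or measure at least `ε²`, then for every `ε > 0` the set of atoms
of `μ` of modulus at least `ε` is finite, and `μ` is discrete away from `0`:
some countable set carries all the mass outside `{0}`. Hence the atoms of `μ`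
can only accumulate at `0`. -/
theorem massGap_measure_discrete (μ : Measure ℝ) [IsFiniteMeasure μ]
    (h : ∀ ε : ℝ, 0 < ε → ε < 1 → ∀ B : Set ℝ, MeasurableSet B →
      B ⊆ {x : ℝ | ε ≤ |x|} → μ B = 0 ∨ ENNReal.ofReal (ε ^ 2) ≤ μ B) :
    (∀ ε : ℝ, 0 < ε → {x : ℝ | ε ≤ |x| ∧ μ {x} ≠ 0}.Finite) ∧
    ∃ D : Set ℝ, D.Countable ∧ μ {x : ℝ | x ≠ 0 ∧ x ∉ D} = 0 := by
  have hpos (ε : ℝ) (hε : 0 < ε) : 0 < ENNReal.ofReal (ε ^ 2) :=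
    ENNReal.ofReal_pos.2 (pow_pos hε 2)
  constructor
  · intro ε hε
    have hδ : 0 < min ε (1 / 2) := lt_min hε (by norm_num)
    have hδ_lt : min ε (1 / 2) < 1 := (min_le_right _ _).trans_lt (by norm_num)
    refine (finite_setOf_le_measure_singleton μ (hpos _ hδ)).subset fun x hx => ?_
    refine (h _ hδ hδ_lt {x} (measurableSet_singleton x) ?_).resolve_left hx.2
    exact Set.singleton_subset_iff.2 ((min_le_left _ _).trans hx.1)
  · refine ⟨{x | μ {x} ≠ 0}, countable_setOf_measure_singleton_ne_zero μ, ?_⟩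
    have hnull (n : ℕ) : μ ({x : ℝ | 1 / ((n : ℝ) + 2) ≤ |x|} ∩ {x | μ {x} = 0}) = 0 := by
      have hn : 0 < 1 / ((n : ℝ) + 2) := by positivity
      have hn_lt : 1 / ((n : ℝ) + 2) < 1 := by
        rw [div_lt_one (by positivity)]
        linarith [n.cast_nonneg (α := ℝ)]
      exact measure_inter_setOf_singleton_eq_zero_of_gap μ (hpos _ hn)
        (measurableSet_le measurable_const measurable_id.abs) (h _ hn hn_lt)
    refine measure_mono_null (fun x hx => ?_) (measure_iUnion_null hnull)
    obtain ⟨n, hn⟩ := exists_nat_one_div_lt (abs_pos.2 hx.1)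
    refine Set.mem_iUnion.2 ⟨n, ?_, not_not.1 hx.2⟩
    refine le_trans ?_ hn.le
    exact one_div_le_one_div_of_le (by positivity) (by linarith)
end
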